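/- Let n ≥ 2 and R > 0. There exists a constant C = C(n,R) > 0 such that for every φ ∈ C^∞((0,∞)×ℝⁿ) with supp φ(t,·) ⊂ {x ∈ ℝⁿ : |x| < t + R} for each t > 0, and for all t > 0, x ∈ ℝⁿ: (1+t)^{(n−1)/2}(1 + |t − r|)^{−1/2} |φ(t,x)| ≤ C Σ_{|a| ≤ [(n−1)/2]+1} ‖∂_x Z^a φ(t,·)‖_{L²(ℝⁿ)}, where r = |x| and [p] denotes the greatest integer not exceeding p. -/

import Mathlib

open MeasureTheory Real Set

noncomputable section

/-- Partial derivative `∂_i` on ℝ^{1+n} (coordinate `0` is time). -/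
def pdn {m : ℕ} (i : Fin m) (u : (Fin m → ℝ) → ℝ) : (Fin m → ℝ) → ℝ :=
  fun y => fderiv ℝ u y (Pi.single i 1)

/-- Euclidean length `|x|` of a space point in ℝⁿ. -/
def radn {n : ℕ} (x : Fin n → ℝ) : ℝ := Real.sqrt (∑ i, (x i) ^ 2)

/-- Index type for the `n`-dimensional Klainerman vector fields:
translations `∂_α`, rotations `Ω_{ij}`, boosts `L_k`, and the scaling field `S`. -/
abbrev KIdx (n : ℕ) := Fin (n + 1) ⊕ (Fin n × Fin n) ⊕ Fin n ⊕ Unit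

/-- The `n`-dimensional Klainerman vector fields (as coefficient vectors);
spatial coordinates are the indices `1, …, n`. -/
def KVFn {n : ℕ} : KIdx n → (Fin (n + 1) → ℝ) → Fin (n + 1) → ℝ
  | Sum.inl α, _ => Pi.single α 1
  | Sum.inr (Sum.inl (i, j)), y => Pi.single j.succ (y i.succ) - Pi.single i.succ (y j.succ)
  | Sum.inr (Sum.inr (Sum.inl k)), y => Pi.single 0 (y k.succ) + Pi.single k.succ (y 0)
  | Sum.inr (Sum.inr (Sum.inr _)), y => y

/-- The Klainerman vector field `Z_i` applied to a function. -/
def Zopn {n : ℕ} (i : KIdx n) (u : (Fin (n + 1) → ℝ) → ℝ) : (Fin (n + 1) → ℝ) → ℝ :=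
  fun y => fderiv ℝ u y (KVFn i y)

/-- Iterated Klainerman fields `Z^a`. -/
def Zitn {n : ℕ} : List (KIdx n) → ((Fin (n + 1) → ℝ) → ℝ) → (Fin (n + 1) → ℝ) → ℝ
  | [], u => u
  | i :: l, u => Zopn i (Zitn l u)

/-- All multi-indices `a` with `|a| ≤ m` (as lists of field indices). -/
def kLists (n : ℕ) : ℕ → List (List (KIdx n))
  | 0 => [[]]
  | m + 1 => [] :: (kLists n m).flatMap fun l =>
      (Finset.univ : Finset (KIdx n)).toList.map fun i => i :: l


theorem int_le_of_ptw {f F F' g : ℝ → ℝ} (hF : ∀ τ, HasDerivAt F (F' τ) τ)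
    (hF' : Continuous F') (hf : Continuous f) (hg : Continuous g)
    (h : ∀ τ ∈ Icc (0:ℝ) 1, f τ ≤ F' τ + g τ) :
    ∫ τ in (0:ℝ)..1, f τ ≤ (F 1 - F 0) + ∫ τ in (0:ℝ)..1, g τ := by
  rw [← intervalIntegral.integral_eq_sub_of_hasDerivAt (fun x _ => hF x)
    (hF'.intervalIntegrable _ _), ← intervalIntegral.integral_add
    (hF'.intervalIntegrable _ _) (hg.intervalIntegrable _ _)]
  exact intervalIntegral.integral_mono_on (by norm_num) (hf.intervalIntegrable _ _)
    ((hF'.add hg).intervalIntegrable _ _) h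

theorem hardy_one (m : ℕ) {K K' : ℝ → ℝ} (hK : ∀ τ, HasDerivAt K (K' τ) τ)
    (hK' : Continuous K') :
    ∫ τ in (0:ℝ)..1, τ ^ m * K τ ^ 2 ≤
      ∫ τ in (0:ℝ)..1, (2 * ((m:ℝ) + 2) ^ 2 + 8) * (τ ^ (m + 2) * (K τ ^ 2 + K' τ ^ 2)) := by
  have hKc : Continuous K := continuous_iff_continuousAt.2 fun x => (hK x).continuousAt
  have hF : ∀ τ, HasDerivAt (fun τ : ℝ => 2 * (τ ^ (m+1) * (1 - τ) * K τ ^ 2))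
      (2 * (((m:ℝ)+1) * τ ^ m * K τ ^ 2 - ((m:ℝ)+2) * τ ^ (m+1) * K τ ^ 2
        + 2 * τ ^ (m+1) * (1 - τ) * K τ * K' τ)) τ := by
    intro τ
    have h1 := ((((hasDerivAt_pow (m+1) τ).mul ((hasDerivAt_id τ).const_sub 1)).mul
      ((hK τ).pow 2)).const_mul 2)
    refine h1.congr_deriv ?_
    simp
    ring
  have := int_le_of_ptw (f := fun τ => τ ^ m * K τ ^ 2)
    (g := fun τ => (2 * ((m:ℝ) + 2) ^ 2 + 8) * (τ ^ (m + 2) * (K τ ^ 2 + K' τ ^ 2)))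
    hF (by fun_prop) (by fun_prop) (by fun_prop) ?_
  · simpa using this
  · rintro τ ⟨h0, h1⟩
    have hp : 0 ≤ τ ^ m := by positivity
    have key : K τ ^ 2 ≤ 2 * (((m:ℝ)+1) * K τ ^ 2 - ((m:ℝ)+2) * τ * K τ ^ 2
        + 2 * τ * (1 - τ) * K τ * K' τ)
        + (2 * ((m:ℝ) + 2) ^ 2 + 8) * (τ ^ 2 * (K τ ^ 2 + K' τ ^ 2)) := by
      have e1 : 0 ≤ (K τ / 2 - 2 * ((m:ℝ)+2) * τ * K τ / 2) ^ 2 * 2 := by positivity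
      have e2 : 0 ≤ (K τ + 4 * τ * (1 - τ) * K' τ) ^ 2 / 2 := by positivity
      have e3 : 8 * τ^2 * (1-τ)^2 * K' τ ^2 ≤ 8 * τ^2 * 1 * K' τ ^ 2 := by
        gcongr
        nlinarith
      have e4 : 0 ≤ (m:ℝ) * K τ ^ 2 := by positivity
      have e5 : 0 ≤ 8 * (τ^2 * K τ ^ 2) := by positivity
      have e6 : 0 ≤ 2 * ((m:ℝ) + 2) ^ 2 * (τ^2 * K' τ ^ 2) := by positivity
      nlinarith
    have := mul_le_mul_of_nonneg_left key hp
    calc _ ≤ _ := this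
      _ = _ := by ring

theorem step_S (m : ℕ) : ∃ C > (0:ℝ), ∀ K K' J : ℝ → ℝ, (∀ τ, HasDerivAt K (K' τ) τ) →
    Continuous K' → Continuous J → (∀ τ ∈ Icc (0:ℝ) 1, K' τ ^ 2 ≤ τ ^ 2 * J τ) →
    (∀ τ, 0 ≤ J τ) →
    ∫ τ in (0:ℝ)..1, τ ^ m * K τ ^ 2 ≤ ∫ τ in (0:ℝ)..1, C * (τ ^ (m + 4) * (K τ ^ 2 + J τ)) := by
  set a : ℝ := 2 * ((m:ℝ) + 2) ^ 2 + 8 with ha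
  set b : ℝ := 2 * (((m+2:ℕ):ℝ) + 2) ^ 2 + 8 with hb
  have ha0 : 0 < a := by positivity
  have hb0 : 0 < b := by positivity
  refine ⟨a * (b + 1), by positivity, ?_⟩
  intro K K' J hK hK' hJ hKJ hJ0
  have hKc : Continuous K := continuous_iff_continuousAt.2 fun x => (hK x).continuousAt
  have h1 := hardy_one m hK hK'
  have h2 := hardy_one (m+2) hK hK'
  rw [← ha] at h1
  rw [← hb] at h2
  have h3 : ∫ τ in (0:ℝ)..1, a * (τ ^ (m + 2) * (K τ ^ 2 + K' τ ^ 2)) =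
      a * (∫ τ in (0:ℝ)..1, τ ^ (m+2) * K τ ^ 2) +
      ∫ τ in (0:ℝ)..1, a * (τ ^ (m+2) * K' τ ^ 2) := by
    rw [← intervalIntegral.integral_const_mul, ← intervalIntegral.integral_add]
    · congr 1; ext τ; ring
    · exact Continuous.intervalIntegrable (by fun_prop) _ _
    · exact Continuous.intervalIntegrable (by fun_prop) _ _
  have h4 := mul_le_mul_of_nonneg_left h2 ha0.le
  refine h1.trans (h3.le.trans ((add_le_add_left h4 _).trans ?_))
  rw [← intervalIntegral.integral_const_mul, ← intervalIntegral.integral_add]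
  · apply intervalIntegral.integral_mono_on (by norm_num)
    · exact Continuous.intervalIntegrable (by fun_prop) _ _
    · exact Continuous.intervalIntegrable (by fun_prop) _ _
    rintro τ ⟨h0, h1⟩
    have q := hKJ τ ⟨h0, h1⟩
    have q2 := hJ0 τ
    have q1 : K' τ ^ 2 ≤ J τ := q.trans (mul_le_of_le_one_left q2 (pow_le_one₀ h0 h1))
    have e1 : a * (b * (τ ^ (m + 2 + 2) * (K τ ^ 2 + K' τ ^ 2))) ≤
        a * (b * (τ ^ (m + 2 + 2) * (K τ ^ 2 + J τ))) := by gcongr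
    have e2 : a * (τ ^ (m + 2) * K' τ ^ 2) ≤ a * (τ ^ (m + 2) * (τ ^ 2 * J τ)) := by gcongr
    have e3 : 0 ≤ a * τ ^ (m+4) * K τ ^ 2 := by positivity
    calc _ ≤ _ := add_le_add e1 e2
      _ ≤ a * (b * (τ ^ (m + 2 + 2) * (K τ ^ 2 + J τ))) + a * (τ ^ (m + 2) * (τ ^ 2 * J τ))
          + a * τ ^ (m+4) * K τ ^ 2 := by linarith
      _ = _ := by ring
  · exact Continuous.intervalIntegrable (by fun_prop) _ _
  · exact Continuous.intervalIntegrable (by fun_prop) _ _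

theorem step_S0 : ∃ C > (0:ℝ), ∀ K K' J : ℝ → ℝ, (∀ τ, HasDerivAt K (K' τ) τ) →
    Continuous K' → Continuous J → (∀ τ ∈ Icc (0:ℝ) 1, K' τ ^ 2 ≤ τ ^ 2 * J τ) →
    (∀ τ, 0 ≤ J τ) →
    K 0 ^ 2 ≤ ∫ τ in (0:ℝ)..1, C * (τ ^ 2 * (K τ ^ 2 + J τ)) := by
  set a : ℝ := 2 * (((0:ℕ):ℝ) + 2) ^ 2 + 8 with ha
  have ha0 : 0 < a := by positivity
  refine ⟨2 * a + 1, by positivity, ?_⟩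
  intro K K' J hK hK' hJ hKJ hJ0
  have hKc : Continuous K := continuous_iff_continuousAt.2 fun x => (hK x).continuousAt
  have h1 := hardy_one 0 hK hK'
  rw [← ha] at h1
  have hF : ∀ τ, HasDerivAt (fun τ : ℝ => ((1 - τ) * K τ ^ 2))
      (- K τ ^ 2 + 2 * (1 - τ) * K τ * K' τ) τ := by
    intro τ
    have h1 := (((hasDerivAt_id τ).const_sub 1)).mul ((hK τ).pow 2)
    refine h1.congr_deriv ?_
    simp
    ring
  have h2 := int_le_of_ptw (f := fun τ => 0)
    (g := fun τ => 2 * (τ ^ 0 * K τ ^ 2) + K' τ ^ 2)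
    hF (by fun_prop) (by fun_prop) (by fun_prop) (by
      rintro τ ⟨h0, h1⟩
      have e2 : 0 ≤ (K τ + (1 - τ) * K' τ) ^ 2 := by positivity
      have e3 : (1-τ)^2 * K' τ ^2 ≤ 1 * K' τ ^ 2 := by
        gcongr
        nlinarith
      simp only [pow_zero]
      nlinarith)
  rw [intervalIntegral.integral_add (Continuous.intervalIntegrable (by fun_prop) _ _)
    (Continuous.intervalIntegrable (by fun_prop) _ _), intervalIntegral.integral_const_mul] at h2
  simp only [intervalIntegral.integral_zero, sub_self, zero_mul, sub_zero, one_mul, zero_sub] at h2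
  have h3 : K 0 ^ 2 ≤ 2 * (∫ τ in (0:ℝ)..1, a * (τ ^ (0 + 2) * (K τ ^ 2 + K' τ ^ 2)))
      + ∫ τ in (0:ℝ)..1, K' τ ^ 2 := by linarith
  refine h3.trans ?_
  rw [← intervalIntegral.integral_const_mul, ← intervalIntegral.integral_add]
  · apply intervalIntegral.integral_mono_on (by norm_num)
    · exact Continuous.intervalIntegrable (by fun_prop) _ _
    · exact Continuous.intervalIntegrable (by fun_prop) _ _
    rintro τ ⟨h0, h1⟩
    have q := hKJ τ ⟨h0, h1⟩
    have q2 := hJ0 τ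
    have q1 : K' τ ^ 2 ≤ J τ := q.trans (mul_le_of_le_one_left q2 (pow_le_one₀ h0 h1))
    have e1 : 2 * (a * (τ ^ (0 + 2) * (K τ ^ 2 + K' τ ^ 2))) ≤
        2 * (a * (τ ^ (0 + 2) * (K τ ^ 2 + J τ))) := by gcongr
    have e3 : 0 ≤ τ ^ 2 * K τ ^ 2 := by positivity
    calc _ ≤ _ := add_le_add e1 q
      _ ≤ 2 * (a * (τ ^ (0 + 2) * (K τ ^ 2 + J τ))) + τ ^ 2 * J τ + τ ^ 2 * K τ ^ 2 := by linarith
      _ = _ := by ring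
  · exact Continuous.intervalIntegrable (by fun_prop) _ _
  · exact Continuous.intervalIntegrable (by fun_prop) _ _

theorem KVFn_contDiff {n : ℕ} (i : KIdx n) : ContDiff ℝ (⊤ : ℕ∞) (KVFn i) := by
  rcases i with a | ⟨i, j⟩ | k | u
  · exact contDiff_const
  · rw [contDiff_pi]
    intro α
    simp only [KVFn, Pi.sub_apply, Pi.single_apply]
    apply ContDiff.sub <;> split_ifs <;> fun_prop
  · rw [contDiff_pi]
    intro α
    simp only [KVFn, Pi.add_apply, Pi.single_apply]
    apply ContDiff.add <;> split_ifs <;> fun_prop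
  · exact contDiff_id

theorem fderiv_contDiff_top {n : ℕ} {w : (Fin n → ℝ) → ℝ} (hw : ContDiff ℝ (⊤ : ℕ∞) w) :
    ContDiff ℝ (⊤ : ℕ∞) (fderiv ℝ w) :=
  hw.fderiv_right (m := (⊤ : ℕ∞)) (by norm_cast)

theorem Zopn_contDiff {n : ℕ} (i : KIdx n) {w : (Fin (n+1) → ℝ) → ℝ}
    (hw : ContDiff ℝ (⊤ : ℕ∞) w) : ContDiff ℝ (⊤ : ℕ∞) (Zopn i w) :=
  (fderiv_contDiff_top hw).clm_apply (KVFn_contDiff i)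

theorem pdn_contDiff {m : ℕ} (i : Fin m) {w : (Fin m → ℝ) → ℝ}
    (hw : ContDiff ℝ (⊤ : ℕ∞) w) : ContDiff ℝ (⊤ : ℕ∞) (pdn i w) :=
  (fderiv_contDiff_top hw).clm_apply contDiff_const

theorem Zitn_contDiff {n : ℕ} {w : (Fin (n+1) → ℝ) → ℝ}
    (hw : ContDiff ℝ (⊤ : ℕ∞) w) (l : List (KIdx n)) : ContDiff ℝ (⊤ : ℕ∞) (Zitn l w) := by
  induction l with
  | nil => exact hw
  | cons i l ih => exact Zopn_contDiff i ih

/-- sum over the multi-index list -/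
def sumL (n s : ℕ) (f : List (KIdx n) → ℝ) : ℝ := ((kLists n s).map f).sum

theorem sum_flatMap_aux {n : ℕ} (f : List (KIdx n) → ℝ) (L : List (List (KIdx n))) :
    ((L.flatMap fun l => (Finset.univ : Finset (KIdx n)).toList.map fun i => i :: l).map f).sum
      = (L.map fun l => ∑ i : KIdx n, f (i :: l)).sum := by
  induction L with
  | nil => simp
  | cons a L ih =>
    rw [List.flatMap_cons, List.map_append, List.sum_append, ih, List.map_cons, List.sum_cons]
    congr 1
    rw [List.map_map, Finset.sum, ← Finset.coe_toList, Multiset.map_coe, Multiset.sum_coe]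
    simp [Function.comp_def]

theorem sumL_succ {n : ℕ} (s : ℕ) (f : List (KIdx n) → ℝ) :
    sumL n (s+1) f = f [] + sumL n s (fun l => ∑ i : KIdx n, f (i :: l)) := by
  rw [sumL, kLists, List.map_cons, List.sum_cons, sum_flatMap_aux]
  rfl

theorem sumL_zero {n : ℕ} (f : List (KIdx n) → ℝ) : sumL n 0 f = f [] := by
  simp [sumL, kLists]

theorem sumL_nonneg {n s : ℕ} {f : List (KIdx n) → ℝ} (hf : ∀ l, 0 ≤ f l) : 0 ≤ sumL n s f := by
  apply List.sum_nonneg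
  simp only [List.mem_map]
  rintro _ ⟨l, _, rfl⟩
  exact hf l

theorem sumL_mono {n : ℕ} (s : ℕ) : ∀ {f : List (KIdx n) → ℝ}, (∀ l, 0 ≤ f l) →
    sumL n s f ≤ sumL n (s+1) f := by
  induction s with
  | zero =>
    intro f hf
    rw [sumL_succ, sumL_zero, sumL_zero]
    have := Finset.sum_nonneg (fun i (_ : i ∈ (Finset.univ : Finset (KIdx n))) => hf [i])
    linarith
  | succ s ih =>
    intro f hf
    rw [sumL_succ, sumL_succ (s+1)]
    gcongr
    exact ih fun l => Finset.sum_nonneg fun i _ => hf _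

theorem sumL_le {n s : ℕ} {f g : List (KIdx n) → ℝ} (h : ∀ l, f l ≤ g l) :
    sumL n s f ≤ sumL n s g := List.sum_le_sum fun l _ => h l

theorem sumL_add {n s : ℕ} (f g : List (KIdx n) → ℝ) :
    sumL n s (fun l => f l + g l) = sumL n s f + sumL n s g := by
  simp [sumL, List.sum_map_add]

theorem sumL_mul {n s : ℕ} (c : ℝ) (f : List (KIdx n) → ℝ) :
    sumL n s (fun l => c * f l) = c * sumL n s f := by
  simp [sumL, List.sum_map_mul_left]

theorem sumL_continuous {X : Type*} [TopologicalSpace X] {n s : ℕ} {f : List (KIdx n) → X → ℝ}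
    (hf : ∀ l, Continuous (f l)) : Continuous fun x => sumL n s fun l => f l x := by
  unfold sumL
  exact continuous_list_sum _ fun l _ => hf l

theorem list_int_sum {ι : Type*} (L : List ι) {f : ι → ℝ → ℝ} (hf : ∀ l, Continuous (f l)) :
    ∫ τ in (0:ℝ)..1, (L.map fun l => f l τ).sum = (L.map fun l => ∫ τ in (0:ℝ)..1, f l τ).sum := by
  induction L with
  | nil => simp
  | cons a L ih =>
    simp only [List.map_cons, List.sum_cons]
    rw [intervalIntegral.integral_add, ih]
    · exact (hf a).intervalIntegrable _ _
    · exact (continuous_list_sum _ fun l _ => hf l).intervalIntegrable _ _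

theorem sumL_int {n s : ℕ} {f : List (KIdx n) → ℝ → ℝ} (hf : ∀ l, Continuous (f l)) :
    ∫ τ in (0:ℝ)..1, sumL n s (fun l => f l τ) = sumL n s fun l => ∫ τ in (0:ℝ)..1, f l τ :=
  list_int_sum _ hf

theorem step_SL (m : ℕ) : ∃ C > (0:ℝ), ∀ (n s : ℕ) (K K' J : List (KIdx n) → ℝ → ℝ),
    (∀ l τ, HasDerivAt (K l) (K' l τ) τ) →
    (∀ l, Continuous (K' l)) → (∀ l, Continuous (J l)) →
    (∀ l, ∀ τ ∈ Icc (0:ℝ) 1, K' l τ ^ 2 ≤ τ ^ 2 * J l τ) →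
    (∀ l τ, 0 ≤ J l τ) →
    ∫ τ in (0:ℝ)..1, τ ^ m * sumL n s (fun l => K l τ ^ 2) ≤
      ∫ τ in (0:ℝ)..1, C * (τ ^ (m + 4) * sumL n s fun l => (K l τ ^ 2 + J l τ)) := by
  obtain ⟨C, hC, h⟩ := step_S m
  refine ⟨C, hC, ?_⟩
  intro n s K K' J hK hK' hJ hKJ hJ0
  have hKc : ∀ l, Continuous (K l) := fun l =>
    continuous_iff_continuousAt.2 fun x => (hK l x).continuousAt
  simp only [← sumL_mul]
  rw [sumL_int fun l => by fun_prop, sumL_int fun l => by fun_prop]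
  exact sumL_le fun l => h _ _ _ (hK l) (hK' l) (hJ l) (hKJ l) (hJ0 l)

/-- path lemma -/
theorem path_P (n k : ℕ) (M : ℝ) (hM : 0 < M) : ∃ C > (0:ℝ), ∀ (φ : (Fin (n+1) → ℝ) → ℝ),
    ContDiff ℝ (⊤ : ℕ∞) φ → ∀ p p' : ℝ → (Fin (n+1) → ℝ), (∀ τ, HasDerivAt p (p' τ) τ) →
    Continuous p' →
    (∀ w : (Fin (n+1) → ℝ) → ℝ, ContDiff ℝ (⊤ : ℕ∞) w → ∀ τ ∈ Icc (0:ℝ) 1,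
      (fderiv ℝ w (p τ) (p' τ)) ^ 2 ≤ τ ^ 2 * (M * ∑ i, (Zopn i w (p τ)) ^ 2)) →
    φ (p 0) ^ 2 ≤ ∫ τ in (0:ℝ)..1, C * (τ ^ (4 * k + 2) *
      sumL n (k+1) fun l => (Zitn l φ (p τ)) ^ 2) := by
  induction k with
  | zero =>
    obtain ⟨C, hC, h⟩ := step_S0
    refine ⟨C * (1 + M), by positivity, ?_⟩
    intro φ hφ p p' hp hp' hb
    have hpc : Continuous p := continuous_iff_continuousAt.2 fun x => (hp x).continuousAt
    have hZc : ∀ l, Continuous fun τ => Zitn l φ (p τ) := fun l =>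
      (Zitn_contDiff hφ l).continuous.comp hpc
    have hZc' : ∀ i : KIdx n, Continuous fun τ => Zopn i φ (p τ) := fun i => hZc [i]
    have h1 := h (fun τ => φ (p τ)) (fun τ => fderiv ℝ φ (p τ) (p' τ))
      (fun τ => M * ∑ i, (Zopn i φ (p τ)) ^ 2) (fun τ => by
        have := (hφ.differentiable (by simp) (p τ)).hasFDerivAt.comp_hasDerivAt τ (hp τ)
        exact this)
      (((fderiv_contDiff_top hφ).continuous.comp hpc).clm_apply hp')
      (by fun_prop) (hb φ hφ) (fun τ => by positivity)
    have hφc : Continuous fun τ => φ (p τ) := hZc []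
    refine h1.trans ?_
    apply intervalIntegral.integral_mono_on (by norm_num)
    · exact Continuous.intervalIntegrable (by fun_prop) _ _
    · have := sumL_continuous (n := n) (s := 0+1) fun l => (hZc l).pow 2
      exact Continuous.intervalIntegrable (by fun_prop) _ _
    rintro τ ⟨h0, h1⟩
    rw [sumL_succ, sumL_zero]
    simp only [Zitn]
    set A := φ (p τ) ^ 2
    set B := ∑ i, Zopn i φ (p τ) ^ 2
    have hA : 0 ≤ A := by positivity
    have hB : 0 ≤ B := by positivity
    have : A + M * B ≤ (1 + M) * (A + B) := by nlinarith [mul_nonneg hM.le hA]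
    calc C * (τ ^ 2 * (A + M * B)) ≤ C * (τ ^ 2 * ((1 + M) * (A + B))) := by gcongr
      _ = _ := by ring
  | succ k ih =>
    obtain ⟨C, hC, h⟩ := ih
    obtain ⟨C', hC', h'⟩ := step_SL (4 * k + 2)
    refine ⟨C * C' * (1 + M), by positivity, ?_⟩
    intro φ hφ p p' hp hp' hb
    have hpc : Continuous p := continuous_iff_continuousAt.2 fun x => (hp x).continuousAt
    have hZc : ∀ l, Continuous fun τ => Zitn l φ (p τ) := fun l =>
      (Zitn_contDiff hφ l).continuous.comp hpc
    have hZc' : ∀ (i : KIdx n) l, Continuous fun τ => Zopn i (Zitn l φ) (p τ) :=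
      fun i l => hZc (i :: l)
    have h1 := h φ hφ p p' hp hp' hb
    have h2 := h' n (k+1) (fun l τ => Zitn l φ (p τ))
      (fun l τ => fderiv ℝ (Zitn l φ) (p τ) (p' τ))
      (fun l τ => M * ∑ i, (Zopn i (Zitn l φ) (p τ)) ^ 2) (fun l τ => by
        have := ((Zitn_contDiff hφ l).differentiable (by simp)
          (p τ)).hasFDerivAt.comp_hasDerivAt τ (hp τ)
        exact this)
      (fun l => ((fderiv_contDiff_top (Zitn_contDiff hφ l)).continuous.comp hpc).clm_apply hp')
      (fun l => by fun_prop) (fun l => hb _ (Zitn_contDiff hφ l)) (fun l τ => by positivity)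
    rw [intervalIntegral.integral_const_mul] at h1
    refine h1.trans ((mul_le_mul_of_nonneg_left h2 hC.le).trans ?_)
    rw [← intervalIntegral.integral_const_mul]
    apply intervalIntegral.integral_mono_on (by norm_num)
    · have := sumL_continuous (n := n) (s := k+1)
        (f := fun l τ => (Zitn l φ (p τ) ^ 2 + M * ∑ i, Zopn i (Zitn l φ) (p τ) ^ 2))
        fun l => by fun_prop
      exact Continuous.intervalIntegrable (by fun_prop) _ _
    · have := sumL_continuous (n := n) (s := k+1+1) fun l => (hZc l).pow 2
      exact Continuous.intervalIntegrable (by fun_prop) _ _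
    rintro τ ⟨h0, h1⟩
    rw [sumL_add, sumL_mul]
    have e1 := sumL_mono (n := n) (k+1) (f := fun l => Zitn l φ (p τ) ^ 2) fun l => by positivity
    have e2 := sumL_succ (n := n) (k+1) (f := fun l => Zitn l φ (p τ) ^ 2)
    have e3 : 0 ≤ Zitn [] φ (p τ) ^ 2 := by positivity
    simp only [Zitn] at e2 e3
    set B := sumL n (k+1) fun l => ∑ i, Zopn i (Zitn l φ) (p τ) ^ 2
    set A := sumL n (k+1) fun l => Zitn l φ (p τ) ^ 2
    set D := sumL n (k+1+1) fun l => Zitn l φ (p τ) ^ 2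
    have : A + M * B ≤ (1 + M) * D := by
      have : B ≤ D := by linarith
      nlinarith
    calc _ ≤ C * (C' * (τ ^ (4 * k + 2 + 4) * ((1 + M) * D))) := by gcongr
      _ = _ := by ring

theorem lint_affine (d : ℕ) (G : (Fin d → ℝ) → ENNReal) (hG : Measurable G) (x0 : Fin d → ℝ)
    (c : ℝ) (hc : 0 < c) :
    ∫⁻ v, G (x0 + c • v) = ENNReal.ofReal ((c ^ d)⁻¹) * ∫⁻ v, G v := by
  have h1 : ∫⁻ v, G (x0 + c • v) = ∫⁻ v, G (x0 + v) ∂(Measure.map (fun v : Fin d → ℝ => c • v) volume) := by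
    rw [lintegral_map (by fun_prop) (by fun_prop)]
  rw [h1, Measure.map_addHaar_smul _ hc.ne', lintegral_smul_measure,
    lintegral_add_left_eq_self (fun v => G v) x0]
  simp [abs_of_pos hc]

theorem avg_lint (d N : ℕ) (hN : 2 * d ≤ N) (G : (Fin d → ℝ) → ENNReal) (hG : Measurable G)
    (x0 : Fin d → ℝ) (c : ℝ) (hc : 0 < c) (A : ENNReal)
    (h : ∀ v ∈ Icc (0 : Fin d → ℝ) 1,
      A ≤ ∫⁻ τ in Ioc (0:ℝ) 1, ENNReal.ofReal (τ ^ N) * G (x0 + (τ ^ 2 * c) • v)) :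
    A ≤ ENNReal.ofReal ((c ^ d)⁻¹) * ∫⁻ v, G v := by
  have hvol : volume (Icc (0 : Fin d → ℝ) 1) = 1 := by
    rw [Real.volume_Icc_pi]; simp
  calc A = ∫⁻ v in Icc (0 : Fin d → ℝ) 1, A := by simp [hvol]
    _ ≤ ∫⁻ v in Icc (0 : Fin d → ℝ) 1,
        ∫⁻ τ in Ioc (0:ℝ) 1, ENNReal.ofReal (τ ^ N) * G (x0 + (τ ^ 2 * c) • v) :=
      setLIntegral_mono' measurableSet_Icc h
    _ = ∫⁻ τ in Ioc (0:ℝ) 1, ∫⁻ v in Icc (0 : Fin d → ℝ) 1,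
          ENNReal.ofReal (τ ^ N) * G (x0 + (τ ^ 2 * c) • v) := by
      apply lintegral_lintegral_swap
      apply Measurable.aemeasurable
      unfold Function.uncurry
      fun_prop
    _ ≤ ∫⁻ τ in Ioc (0:ℝ) 1, ENNReal.ofReal ((c ^ d)⁻¹) * ∫⁻ v, G v := by
      apply setLIntegral_mono' measurableSet_Ioc
      rintro τ ⟨h0, h1⟩
      calc _ ≤ ∫⁻ v, ENNReal.ofReal (τ ^ N) * G (x0 + (τ ^ 2 * c) • v) := setLIntegral_le_lintegral _ _
        _ = ENNReal.ofReal (τ ^ N) * (ENNReal.ofReal (((τ ^ 2 * c) ^ d)⁻¹) * ∫⁻ v, G v) := by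
          rw [lintegral_const_mul _ (by fun_prop), lint_affine d G hG x0 _ (by positivity)]
        _ ≤ _ := by
          rw [← mul_assoc, ← ENNReal.ofReal_mul (by positivity)]
          gcongr
          have : τ ^ N ≤ τ ^ (2 * d) := pow_le_pow_of_le_one h0.le h1 hN
          rw [mul_pow, ← pow_mul, mul_inv, ← mul_assoc]
          apply mul_le_of_le_one_left (by positivity)
          rw [← div_eq_mul_inv]
          exact div_le_one_of_le₀ this (by positivity)
    _ = _ := by simp

theorem avg_real (d N : ℕ) (hN : 2 * d ≤ N) (g : (Fin d → ℝ) → ℝ) (hg : Continuous g)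
    (hg0 : ∀ x, 0 ≤ g x) (S : Set (Fin d → ℝ)) (hS : MeasurableSet S)
    (x0 : Fin d → ℝ) (c : ℝ) (hc : 0 < c) (a : ℝ)
    (hxS : ∀ v ∈ Icc (0 : Fin d → ℝ) 1, ∀ τ ∈ Icc (0:ℝ) 1, x0 + (τ ^ 2 * c) • v ∈ S)
    (h : ∀ v ∈ Icc (0 : Fin d → ℝ) 1, a ≤ ∫ τ in (0:ℝ)..1, τ ^ N * g (x0 + (τ ^ 2 * c) • v)) :
    ENNReal.ofReal a ≤ ENNReal.ofReal ((c ^ d)⁻¹) * ∫⁻ v in S, ENNReal.ofReal (g v) := by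
  have h1 := avg_lint d N hN (S.indicator fun v => ENNReal.ofReal (g v))
    (Measurable.indicator (by fun_prop) hS) x0 c hc (ENNReal.ofReal a) ?_
  · rwa [lintegral_indicator hS] at h1
  · intro v hv
    refine (ENNReal.ofReal_le_ofReal (h v hv)).trans ?_
    rw [intervalIntegral.integral_of_le (by norm_num), ofReal_integral_eq_lintegral_ofReal]
    · apply setLIntegral_mono' measurableSet_Ioc
      rintro τ ⟨h0, h1⟩
      rw [indicator_of_mem (hxS v hv τ ⟨h0.le, h1⟩), ENNReal.ofReal_mul (by positivity)]
    · refine (intervalIntegrable_iff_integrableOn_Ioc_of_le (by norm_num)).1 ?_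
      exact Continuous.intervalIntegrable (by fun_prop) _ _
    · rw [Filter.EventuallyLE, ae_restrict_iff' measurableSet_Ioc]
      refine Filter.Eventually.of_forall ?_
      rintro τ ⟨h0, h1⟩
      exact mul_nonneg (by positivity) (hg0 _)

theorem abs_le_radn {n : ℕ} (x : Fin n → ℝ) (k : Fin n) : |x k| ≤ radn x := by
  unfold radn
  rw [← Real.sqrt_sq_eq_abs]
  exact Real.sqrt_le_sqrt (Finset.single_le_sum (f := fun i => x i ^ 2)
    (fun i _ => sq_nonneg _) (Finset.mem_univ k))

theorem radn_sq {n : ℕ} (x : Fin n → ℝ) : radn x ^ 2 = ∑ i, x i ^ 2 :=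
  Real.sq_sqrt (Finset.sum_nonneg fun i _ => sq_nonneg _)

theorem radn_nonneg {n : ℕ} (x : Fin n → ℝ) : 0 ≤ radn x := Real.sqrt_nonneg _

theorem radn_continuous {n : ℕ} : Continuous (radn : (Fin n → ℝ) → ℝ) := by
  unfold radn; fun_prop

theorem Zitn_vanish {n : ℕ} {R : ℝ} {φ : (Fin (n+1) → ℝ) → ℝ}
    (hv : ∀ t : ℝ, 0 < t → ∀ x : Fin n → ℝ, t + R ≤ radn x → φ (Fin.cons t x) = 0)
    (l : List (KIdx n)) (y : Fin (n+1) → ℝ) (h0 : 0 < y 0) (h1 : y 0 + R < radn (Fin.tail y)) :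
    Zitn l φ y = 0 := by
  have hU : IsOpen {y : Fin (n+1) → ℝ | 0 < y 0 ∧ y 0 + R < radn (Fin.tail y)} := by
    apply IsOpen.and
    · exact isOpen_lt (by fun_prop) (by fun_prop)
    · refine isOpen_lt (by fun_prop) (radn_continuous.comp ?_)
      unfold Fin.tail
      fun_prop
  induction l generalizing y with
  | nil =>
    have := hv (y 0) h0 (Fin.tail y) h1.le
    rwa [Fin.cons_self_tail] at this
  | cons i l ih =>
    have : Zitn l φ =ᶠ[nhds y] fun _ => 0 := by
      filter_upwards [hU.mem_nhds ⟨h0, h1⟩] with z hz using ih z hz.1 hz.2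
    simp only [Zitn, Zopn]
    rw [this.fderiv_eq]
    simp

theorem cons_hasFDerivAt {n : ℕ} (t : ℝ) (z : Fin n → ℝ) :
    HasFDerivAt (fun z : Fin n → ℝ => (Fin.cons t z : Fin (n+1) → ℝ))
      (ContinuousLinearMap.pi (Fin.cons (0 : (Fin n → ℝ) →L[ℝ] ℝ)
        fun i : Fin n => (ContinuousLinearMap.proj i : (Fin n → ℝ) →L[ℝ] ℝ))) z := by
  rw [hasFDerivAt_pi']
  intro i
  refine Fin.cases ?_ (fun i => ?_) i
  · simpa using! hasFDerivAt_const t z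
  · simpa using! hasFDerivAt_apply i z

theorem cons_contDiff {n : ℕ} (t : ℝ) :
    ContDiff ℝ (⊤ : ℕ∞) (fun z : Fin n → ℝ => (Fin.cons t z : Fin (n+1) → ℝ)) := by
  rw [contDiff_pi]
  intro i
  refine Fin.cases ?_ (fun i => ?_) i
  · simpa using! contDiff_const
  · simp only [Fin.cons_succ]; fun_prop

theorem cons_continuous {n : ℕ} (t : ℝ) :
    Continuous (fun z : Fin n → ℝ => (Fin.cons t z : Fin (n+1) → ℝ)) := (cons_contDiff t).continuous

theorem slice_fderiv {n : ℕ} {w : (Fin (n+1) → ℝ) → ℝ} (hw : ContDiff ℝ (⊤ : ℕ∞) w) (t : ℝ)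
    (z v : Fin n → ℝ) : fderiv ℝ (fun z : Fin n → ℝ => w (Fin.cons t z)) z v =
      fderiv ℝ w (Fin.cons t z) (Fin.cons 0 v) := by
  have := (hw.differentiable (by simp) (Fin.cons t z)).hasFDerivAt.comp z (cons_hasFDerivAt t z)
  have h2 := this.fderiv
  simp only [Function.comp_def] at h2
  rw [h2]
  simp only [ContinuousLinearMap.comp_apply]
  congr 1
  ext i
  refine Fin.cases ?_ (fun i => ?_) i <;> simp

theorem cons_single {n : ℕ} (k : Fin n) :
    (Fin.cons 0 (Pi.single k 1) : Fin (n+1) → ℝ) = Pi.single k.succ 1 := by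
  ext i
  refine Fin.cases ?_ (fun i => ?_) i
  · simp
  · simp [Pi.single_apply]

theorem slice_pdn {n : ℕ} {w : (Fin (n+1) → ℝ) → ℝ} (hw : ContDiff ℝ (⊤ : ℕ∞) w) (t : ℝ)
    (z : Fin n → ℝ) (k : Fin n) :
    pdn k (fun z : Fin n → ℝ => w (Fin.cons t z)) z = pdn k.succ w (Fin.cons t z) := by
  rw [pdn, slice_fderiv hw, cons_single, pdn]

theorem fderiv_cons_sum {n : ℕ} (w : (Fin (n+1) → ℝ) → ℝ) (y : Fin (n+1) → ℝ) (v : Fin n → ℝ) :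
    fderiv ℝ w y (Fin.cons 0 v) = ∑ k, v k * pdn k.succ w y := by
  have : (Fin.cons 0 v : Fin (n+1) → ℝ) = ∑ k : Fin n, v k • Pi.single k.succ 1 := by
    ext i
    refine Fin.cases ?_ (fun i => ?_) i
    · simp [Finset.sum_apply]
    · simp [Finset.sum_apply, Pi.single_apply]
  rw [this, map_sum]
  simp [pdn]

theorem compact_of_van {n : ℕ} {u : (Fin n → ℝ) → ℝ} {ρ : ℝ} (h : ∀ x, ρ < radn x → u x = 0) :
    HasCompactSupport u := by
  apply HasCompactSupport.intro (isCompact_closedBall (0 : Fin n → ℝ) |ρ|)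
  intro x hx
  apply h
  by_contra! hc
  apply hx
  rw [mem_closedBall_zero_iff, pi_norm_le_iff_of_nonneg (abs_nonneg _)]
  intro i
  exact ((abs_le_radn x i).trans hc).trans (le_abs_self _)

theorem pdn_compact {n : ℕ} {u : (Fin n → ℝ) → ℝ} (hu : HasCompactSupport u) (k : Fin n) :
    HasCompactSupport (pdn k u) := hu.fderiv_apply ℝ _

theorem sq_integrable {n : ℕ} {u : (Fin n → ℝ) → ℝ} (hu : HasCompactSupport u)
    (hc : Continuous u) : Integrable fun z => u z ^ 2 := by
  have h1 : HasCompactSupport fun z => u z ^ 2 :=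
    hu.comp_left (g := fun x : ℝ => x ^ 2) (by norm_num)
  exact Continuous.integrable_of_hasCompactSupport (by fun_prop) h1

theorem poincare {n : ℕ} {u : (Fin n → ℝ) → ℝ} (hu : ContDiff ℝ (⊤ : ℕ∞) u) {ρ : ℝ}
    (h : ∀ x, ρ < radn x → u x = 0) (k : Fin n) :
    ∫ z, u z ^ 2 ≤ 4 * ρ ^ 2 * ∫ z, pdn k u z ^ 2 := by
  have hc := compact_of_van h
  have hd := pdn_compact hc k
  have hdc : Continuous (pdn k u) := (pdn_contDiff k hu).continuous
  have hu' : Differentiable ℝ u := hu.differentiable (by simp)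
  have huc := hu.continuous
  have hfd : ∀ z, fderiv ℝ (fun z => u z ^ 2) z (Pi.single k 1) = 2 * u z * pdn k u z := by
    intro z
    have := ((hu' z).hasFDerivAt.pow 2).fderiv
    rw [this]
    simp [pdn]
  have hproj : ∀ z : Fin n → ℝ, fderiv ℝ (fun z : Fin n → ℝ => z k) z (Pi.single k 1) = 1 := by
    intro z
    rw [(hasFDerivAt_apply k z).fderiv]
    simp
  have hI : Integrable (fun z => u z ^ 2) := sq_integrable hc hu.continuous
  have hI2 : Integrable (fun z => z k * (2 * u z * pdn k u z)) := by
    apply Continuous.integrable_of_hasCompactSupport (by fun_prop)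
    have h1 : HasCompactSupport (fun z => 2 * u z * pdn k u z) :=
      HasCompactSupport.mul_left hd
    exact HasCompactSupport.mul_left h1
  have hI3 : Integrable (fun z : Fin n → ℝ => z k * u z ^ 2) := by
    apply Continuous.integrable_of_hasCompactSupport (by fun_prop)
    exact HasCompactSupport.mul_left (hc.comp_left (g := fun x : ℝ => x ^ 2) (by norm_num))
  have hI4 : Integrable (fun z => pdn k u z ^ 2) := sq_integrable hd hdc
  have key := integral_mul_fderiv_eq_neg_fderiv_mul_of_integrable (μ := (volume : Measure (Fin n → ℝ)))
    (f := fun z : Fin n → ℝ => z k) (g := fun z => u z ^ 2) (v := Pi.single k 1)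
    (by simpa only [hproj, one_mul] using hI) (by simpa only [hfd] using hI2) hI3
    (fun z _ => by fun_prop) (fun z _ => by fun_prop)
  simp only [hproj, hfd, one_mul] at key
  have h5 : - ∫ z, z k * (2 * u z * pdn k u z) ≤ ∫ z, (1/2 * u z ^ 2 + 2 * ρ ^ 2 * pdn k u z ^ 2) := by
    rw [← integral_neg]
    apply integral_mono hI2.neg ((hI.const_mul _).add (hI4.const_mul _))
    intro z
    change -(z k * (2 * u z * pdn k u z)) ≤ 1/2 * u z ^ 2 + 2 * ρ ^ 2 * pdn k u z ^ 2
    by_cases hz : u z = 0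
    · simp [hz]; positivity
    · have h1 : radn z ≤ ρ := by
        by_contra! hh
        exact hz (h z hh)
      have h2 : z k ^ 2 ≤ ρ ^ 2 := by
        rw [← sq_abs (z k)]
        exact pow_le_pow_left₀ (abs_nonneg _) ((abs_le_radn z k).trans h1) 2
      have h3 := mul_le_mul_of_nonneg_right h2 (sq_nonneg (pdn k u z))
      nlinarith [sq_nonneg (u z + 2 * z k * pdn k u z)]
  rw [integral_add (hI.const_mul _) (hI4.const_mul _), integral_const_mul, integral_const_mul] at h5
  linarith

theorem list_int_sum' {X ι : Type*} [MeasurableSpace X] {μ : Measure X} (L : List ι)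
    {f : ι → X → ℝ} (hf : ∀ l, Integrable (f l) μ) :
    Integrable (fun x => (L.map fun l => f l x).sum) μ ∧
    ∫ x, (L.map fun l => f l x).sum ∂μ = (L.map fun l => ∫ x, f l x ∂μ).sum := by
  induction L with
  | nil => simp
  | cons a L ih =>
    simp only [List.map_cons, List.sum_cons]
    exact ⟨(hf a).add ih.1, by rw [integral_add (hf a) ih.1, ih.2]⟩

/-- the energy -/
def Den (n : ℕ) (φ : (Fin (n+1) → ℝ) → ℝ) (t : ℝ) : ℝ :=
  sumL n ((n-1)/2+1) fun l => ∑ k : Fin n, ∫ z : Fin n → ℝ, (pdn k.succ (Zitn l φ) (Fin.cons t z)) ^ 2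

theorem slice_facts {n : ℕ} {R : ℝ} {φ : (Fin (n+1) → ℝ) → ℝ} (hφ : ContDiff ℝ (⊤ : ℕ∞) φ)
    (hv : ∀ t : ℝ, 0 < t → ∀ x : Fin n → ℝ, t + R ≤ radn x → φ (Fin.cons t x) = 0)
    (l : List (KIdx n)) {t : ℝ} (ht : 0 < t) :
    Integrable (fun z : Fin n → ℝ => Zitn l φ (Fin.cons t z) ^ 2) ∧
    (∀ k : Fin n, Integrable (fun z : Fin n → ℝ => pdn k.succ (Zitn l φ) (Fin.cons t z) ^ 2)) ∧
    (∀ k : Fin n, ∫ z : Fin n → ℝ, Zitn l φ (Fin.cons t z) ^ 2 ≤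
      4 * (t + R) ^ 2 * ∫ z : Fin n → ℝ, pdn k.succ (Zitn l φ) (Fin.cons t z) ^ 2) := by
  have hw := Zitn_contDiff hφ l
  have hu : ContDiff ℝ (⊤ : ℕ∞) (fun z : Fin n → ℝ => Zitn l φ (Fin.cons t z)) :=
    hw.comp (cons_contDiff t)
  have h0 : ∀ x : Fin n → ℝ, t + R < radn x → Zitn l φ (Fin.cons t x) = 0 := fun x hx =>
    Zitn_vanish hv l _ (by simpa using ht) (by simpa using hx)
  have hc := compact_of_van h0
  refine ⟨sq_integrable hc hu.continuous, fun k => ?_, fun k => ?_⟩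
  · have := sq_integrable (pdn_compact hc k) (pdn_contDiff k hu).continuous
    simpa only [slice_pdn hw] using this
  · have := poincare hu h0 k
    simpa only [slice_pdn hw] using this

theorem region_int (n : ℕ) (hn : 2 ≤ n) (M : ℝ) (hM : 0 < M) : ∃ C > (0:ℝ), ∀ (R : ℝ)
    (φ : (Fin (n+1) → ℝ) → ℝ), ContDiff ℝ (⊤ : ℕ∞) φ →
    (∀ t : ℝ, 0 < t → ∀ x : Fin n → ℝ, t + R ≤ radn x → φ (Fin.cons t x) = 0) →
    ∀ t : ℝ, 0 < t → ∀ (x0 : Fin n → ℝ) (c : ℝ), 0 < c →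
    (∀ w : (Fin (n+1) → ℝ) → ℝ, ContDiff ℝ (⊤ : ℕ∞) w → ∀ v ∈ Icc (0 : Fin n → ℝ) 1,
      ∀ τ ∈ Icc (0:ℝ) 1,
      c ^ 2 * (fderiv ℝ w (Fin.cons t (x0 + (τ ^ 2 * c) • v)) (Fin.cons 0 v)) ^ 2 ≤
        M * ∑ i, (Zopn i w (Fin.cons t (x0 + (τ ^ 2 * c) • v))) ^ 2) →
    c ^ n * φ (Fin.cons t x0) ^ 2 ≤ C * ((t + R) ^ 2 + c ^ 2) * Den n φ t := by
  obtain ⟨C1, hC1, H1⟩ := path_P n ((n-1)/2) (4 * M) (by positivity)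
  obtain ⟨C2, hC2, H2⟩ := step_SL (4 * ((n-1)/2) + 2)
  refine ⟨C1 * C2 * (4 + 4 * n), by positivity, ?_⟩
  intro R φ hφ hv t ht x0 c hc hb
  set s := (n-1)/2+1 with hs
  set W : List (KIdx n) → (Fin n → ℝ) → ℝ := fun l z => Zitn l φ (Fin.cons t z) with hW
  set P : List (KIdx n) → (Fin n → ℝ) → ℝ := fun l z =>
    ∑ k : Fin n, pdn k.succ (Zitn l φ) (Fin.cons t z) ^ 2 with hP
  have hWc : ∀ l, Continuous (W l) := fun l =>
    (Zitn_contDiff hφ l).continuous.comp (cons_continuous t)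
  have hPc : ∀ l, Continuous (P l) := fun l => by
    refine continuous_finsetSum _ fun k _ => Continuous.pow ?_ 2
    exact (pdn_contDiff _ (Zitn_contDiff hφ l)).continuous.comp (cons_continuous t)
  have hP0 : ∀ l z, 0 ≤ P l z := fun l z => by positivity
  set g : (Fin n → ℝ) → ℝ := fun z =>
    C1 * (C2 * sumL n s fun l => (W l z ^ 2 + 4 * c ^ 2 * n * P l z)) with hg
  have hgc : Continuous g := by
    have := sumL_continuous (n := n) (s := s)
      (f := fun l z => (W l z ^ 2 + 4 * c ^ 2 * n * P l z)) (fun l => by fun_prop)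
    fun_prop
  have hg0 : ∀ z, 0 ≤ g z := fun z => by
    have := sumL_nonneg (n := n) (s := s) (f := fun l => (W l z ^ 2 + 4 * c ^ 2 * n * P l z))
      fun l => by have := hP0 l z; positivity
    positivity
  have havg := avg_real n (4 * ((n-1)/2) + 2 + 4) (by omega) g hgc hg0 univ MeasurableSet.univ
    x0 c hc (φ (Fin.cons t x0) ^ 2) (fun _ _ _ _ => mem_univ _) (by
      intro v hvI
      have hp : ∀ τ : ℝ, HasDerivAt (fun τ : ℝ => (Fin.cons t (x0 + (τ ^ 2 * c) • v) : Fin (n+1) → ℝ))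
          ((2 * τ * c) • (Fin.cons 0 v : Fin (n+1) → ℝ)) τ := by
        intro τ
        rw [hasDerivAt_pi]
        intro i
        refine Fin.cases ?_ (fun i => ?_) i
        · simpa using hasDerivAt_const τ t
        · have := ((((hasDerivAt_pow 2 τ).mul_const c).mul_const (v i)).const_add (x0 i))
          simpa using this
      have hp' : Continuous fun τ : ℝ => ((2 * τ * c) • (Fin.cons 0 v : Fin (n+1) → ℝ)) := by
        fun_prop
      have hpc : Continuous (fun τ : ℝ => (Fin.cons t (x0 + (τ ^ 2 * c) • v) : Fin (n+1) → ℝ)) :=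
        continuous_iff_continuousAt.2 fun x => (hp x).continuousAt
      have h1 := H1 φ hφ _ _ hp hp' (by
        intro w hw τ hτ
        have := hb w hw v hvI τ hτ
        rw [map_smul, smul_eq_mul]
        have h2 := mul_le_mul_of_nonneg_left this (by positivity : 0 ≤ 4 * τ ^ 2)
        calc _ = _ := by ring
          _ ≤ _ := h2
          _ = _ := by ring)
      have h2 := H2 n s (fun l τ => W l (x0 + (τ ^ 2 * c) • v))
        (fun l τ => fderiv ℝ (Zitn l φ) (Fin.cons t (x0 + (τ ^ 2 * c) • v))
          ((2 * τ * c) • (Fin.cons 0 v : Fin (n+1) → ℝ)))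
        (fun l τ => 4 * c ^ 2 * n * P l (x0 + (τ ^ 2 * c) • v))
        (fun l τ => by
          have := ((Zitn_contDiff hφ l).differentiable (by simp)
            (Fin.cons t (x0 + (τ ^ 2 * c) • v))).hasFDerivAt.comp_hasDerivAt τ (hp τ)
          exact this)
        (fun l => ((fderiv_contDiff_top (Zitn_contDiff hφ l)).continuous.comp hpc).clm_apply hp')
        (fun l => by fun_prop)
        (fun l τ hτ => by
          rw [map_smul, smul_eq_mul, fderiv_cons_sum]
          have h3 : (∑ k, v k * pdn k.succ (Zitn l φ) (Fin.cons t (x0 + (τ ^ 2 * c) • v))) ^ 2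
              ≤ n * P l (x0 + (τ ^ 2 * c) • v) := by
            refine (sq_sum_le_card_mul_sum_sq).trans ?_
            simp only [Finset.card_univ, Fintype.card_fin]
            refine mul_le_mul_of_nonneg_left (Finset.sum_le_sum fun k _ => ?_) (by positivity)
            simp only [mul_pow]
            apply mul_le_of_le_one_left (by positivity)
            exact pow_le_one₀ (hvI.1 k) (hvI.2 k)
          have h4 := mul_le_mul_of_nonneg_left h3 (by positivity : 0 ≤ 4 * τ ^ 2 * c ^ 2)
          calc _ = _ := by ring
            _ ≤ _ := h4
            _ = _ := by ring)
        (fun l τ => by have := hP0 l (x0 + (τ ^ 2 * c) • v); positivity)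
      simp only [zero_pow, ne_eq, OfNat.ofNat_ne_zero, not_false_eq_true, zero_mul, zero_smul,
        add_zero] at h1
      rw [intervalIntegral.integral_const_mul] at h1
      refine h1.trans ((mul_le_mul_of_nonneg_left h2 hC1.le).trans (le_of_eq ?_))
      rw [← intervalIntegral.integral_const_mul]
      congr 1
      ext τ
      simp only [hg]
      ring)
  have hfacts := fun l => slice_facts hφ hv l ht
  have hPI : ∀ l, Integrable (P l) := fun l => integrable_finsetSum _ fun k _ => (hfacts l).2.1 k
  have hsumI := list_int_sum' (kLists n s) (f := fun l z => W l z ^ 2 + 4 * c ^ 2 * n * P l z)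
    (μ := volume) fun l => (hfacts l).1.add ((hPI l).const_mul _)
  have hgI : Integrable g := (hsumI.1.const_mul C2).const_mul C1
  rw [Measure.restrict_univ, ← ofReal_integral_eq_lintegral_ofReal hgI
    (Filter.Eventually.of_forall hg0), ← ENNReal.ofReal_mul (by positivity),
    ENNReal.ofReal_le_ofReal_iff (mul_nonneg (by positivity) (integral_nonneg hg0))] at havg
  have hgle : ∫ z, g z ≤ C1 * C2 * (4 + 4 * n) * ((t + R) ^ 2 + c ^ 2) * Den n φ t := by
    simp only [hg]
    rw [integral_const_mul, integral_const_mul]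
    unfold sumL
    rw [hsumI.2]
    have : ((kLists n s).map fun l => ∫ z, (W l z ^ 2 + 4 * c ^ 2 * n * P l z)).sum ≤
        sumL n s fun l => ((4 + 4 * n) * ((t + R) ^ 2 + c ^ 2)) * ∑ k : Fin n, ∫ z : Fin n → ℝ,
          (pdn k.succ (Zitn l φ) (Fin.cons t z)) ^ 2 := by
      apply List.sum_le_sum
      intro l _
      rw [integral_add (hfacts l).1 ((hPI l).const_mul _), integral_const_mul,
        integral_finsetSum _ fun k _ => (hfacts l).2.1 k]
      have hp := (hfacts l).2.2 ⟨0, by omega⟩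
      have h5 : ∫ z : Fin n → ℝ, (pdn (Fin.succ ⟨0, by omega⟩) (Zitn l φ) (Fin.cons t z)) ^ 2 ≤
          ∑ k : Fin n, ∫ z : Fin n → ℝ, (pdn k.succ (Zitn l φ) (Fin.cons t z)) ^ 2 :=
        Finset.single_le_sum (f := fun k : Fin n => ∫ z : Fin n → ℝ,
          (pdn k.succ (Zitn l φ) (Fin.cons t z)) ^ 2)
          (fun k _ => integral_nonneg fun z => by positivity) (Finset.mem_univ _)
      set T := ∑ k : Fin n, ∫ z : Fin n → ℝ, (pdn k.succ (Zitn l φ) (Fin.cons t z)) ^ 2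
      have hT : 0 ≤ T := Finset.sum_nonneg fun k _ => integral_nonneg fun z => by positivity
      have h6 : 4 * (t + R) ^ 2 * ∫ z : Fin n → ℝ, (pdn (Fin.succ ⟨0, by omega⟩) (Zitn l φ)
        (Fin.cons t z)) ^ 2 ≤ 4 * (t + R) ^ 2 * T := by gcongr
      have h7 : 0 ≤ 4 * c ^ 2 * T := by positivity
      have h8 : 0 ≤ 4 * n * (t + R) ^ 2 * T := by positivity
      calc _ ≤ 4 * (t + R) ^ 2 * T + 4 * c ^ 2 * n * T := by
            gcongr
            exact hp.trans h6
        _ ≤ _ := by nlinarith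
    rw [sumL_mul] at this
    calc _ ≤ C1 * (C2 * ((4 + 4 * n) * ((t + R) ^ 2 + c ^ 2) * Den n φ t)) := by
          gcongr
          exact this
      _ = _ := by ring
  have hcn : 0 < c ^ n := by positivity
  calc _ ≤ c ^ n * ((c ^ n)⁻¹ * ∫ z, g z) := by gcongr
    _ = ∫ z, g z := by field_simp
    _ ≤ _ := hgle

theorem radn_eq_norm {n : ℕ} (x : Fin n → ℝ) : radn x = ‖(WithLp.toLp 2 x : EuclideanSpace ℝ (Fin n))‖ := by
  rw [EuclideanSpace.norm_eq]
  simp [radn]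

theorem radn_add_le {n : ℕ} (x y : Fin n → ℝ) : radn (x + y) ≤ radn x + radn y := by
  simp only [radn_eq_norm, WithLp.toLp_add]
  exact norm_add_le _ _

theorem radn_smul {n : ℕ} (c : ℝ) (y : Fin n → ℝ) : radn (c • y) = |c| * radn y := by
  simp only [radn_eq_norm, WithLp.toLp_smul]
  rw [norm_smul, Real.norm_eq_abs]

theorem radn_le_of {n : ℕ} (x : Fin n → ℝ) (a : ℝ) (ha : 0 ≤ a) (h : ∀ i, |x i| ≤ a) :
    radn x ≤ n * a := by
  unfold radn
  apply Real.sqrt_le_iff.2 ⟨by positivity, ?_⟩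
  calc ∑ i, x i ^ 2 ≤ ∑ i : Fin n, a ^ 2 := by
        apply Finset.sum_le_sum
        intro i _
        rw [← sq_abs]
        exact pow_le_pow_left₀ (abs_nonneg _) (h i) 2
    _ = n * a ^ 2 := by simp
    _ ≤ (n * a) ^ 2 := by
        rw [mul_pow]
        gcongr
        rcases Nat.eq_zero_or_pos n with h | h
        · simp [h]
        · have : (1:ℝ) ≤ n := by exact_mod_cast h
          nlinarith

theorem Z_abs_le {n : ℕ} (w : (Fin (n+1) → ℝ) → ℝ) (y : Fin (n+1) → ℝ) (i : KIdx n) :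
    |fderiv ℝ w y (KVFn i y)| ≤ Real.sqrt (∑ i, Zopn i w y ^ 2) := by
  rw [← Real.sqrt_sq_eq_abs]
  exact Real.sqrt_le_sqrt (Finset.single_le_sum (f := fun i => Zopn i w y ^ 2)
    (fun i _ => sq_nonneg _) (Finset.mem_univ i))

theorem vec_id2 {n : ℕ} (t : ℝ) (x : Fin n → ℝ) (k : Fin n) :
    (t ^ 2 - radn x ^ 2) • (Pi.single k.succ 1 : Fin (n+1) → ℝ) =
      t • KVFn (Sum.inr (Sum.inr (Sum.inl k))) (Fin.cons t x : Fin (n+1) → ℝ)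
      - x k • KVFn (n := n) (Sum.inr (Sum.inr (Sum.inr ()))) (Fin.cons t x : Fin (n+1) → ℝ)
      - ∑ j, x j • KVFn (Sum.inr (Sum.inl (j, k))) (Fin.cons t x : Fin (n+1) → ℝ) := by
  ext i
  rw [radn_sq]
  refine Fin.cases ?_ (fun i => ?_) i
  · simp [KVFn, Finset.sum_apply]
    ring
  · by_cases h : i = k
    · subst h
      simp [KVFn, Finset.sum_apply, Pi.single_apply, mul_sub, Finset.sum_sub_distrib]
      simp only [sq]
    · simp [KVFn, Finset.sum_apply, Pi.single_apply, h]
      ring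

theorem cone_int_bound {n : ℕ} (w : (Fin (n+1) → ℝ) → ℝ) (t : ℝ) (ht : 0 < t) (x : Fin n → ℝ)
    (hx : radn x ≤ 3 / 4 * t) (k : Fin n) :
    t ^ 2 * pdn k.succ w (Fin.cons t x) ^ 2 ≤
      16 * ((n:ℝ) + 2) ^ 2 * ∑ i, Zopn i w (Fin.cons t x) ^ 2 := by
  have h := congrArg (fderiv ℝ w (Fin.cons t x)) (vec_id2 t x k)
  simp only [map_smul, map_sub, map_sum, smul_eq_mul] at h
  have hA := Z_abs_le w (Fin.cons t x)
  have hs : Real.sqrt (∑ i, Zopn i w (Fin.cons t x) ^ 2) ^ 2 = ∑ i, Zopn i w (Fin.cons t x) ^ 2 :=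
    Real.sq_sqrt (by positivity)
  have hA0 : 0 ≤ Real.sqrt (∑ i, Zopn i w (Fin.cons t x) ^ 2) := Real.sqrt_nonneg _
  set A := Real.sqrt (∑ i, Zopn i w (Fin.cons t x) ^ 2)
  rw [← hs]
  have hxt : ∀ j, |x j| ≤ t := fun j => (abs_le_radn x j).trans (by linarith)
  have hr0 := radn_nonneg x
  have e1 : t ^ 2 / 4 ≤ t ^ 2 - radn x ^ 2 := by nlinarith
  have e2 : |(t ^ 2 - radn x ^ 2) * fderiv ℝ w (Fin.cons t x) (Pi.single k.succ 1)| ≤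
      ((n:ℝ) + 2) * t * A := by
    rw [h]
    refine (abs_sub _ _).trans ?_
    refine (add_le_add ((abs_sub _ _).trans (add_le_add (b := t * A) (d := t * A) ?_ ?_))
      (b := t * A + t * A) (d := ∑ j : Fin n, t * A)
      ((Finset.abs_sum_le_sum_abs _ _).trans (Finset.sum_le_sum fun j _ => ?_))).trans ?_
    · rw [abs_mul, abs_of_pos ht]
      exact mul_le_mul_of_nonneg_left (hA _) ht.le
    · rw [abs_mul]
      exact mul_le_mul (hxt k) (hA _) (abs_nonneg _) ht.le
    · rw [abs_mul]
      exact mul_le_mul (hxt j) (hA _) (abs_nonneg _) ht.le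
    · simp
      linarith
  change |(t ^ 2 - radn x ^ 2) * pdn k.succ w (Fin.cons t x)| ≤ _ at e2
  rw [abs_mul, abs_of_nonneg (by nlinarith [sq_nonneg t])] at e2
  have e3 : t ^ 2 / 4 * |pdn k.succ w (Fin.cons t x)| ≤ ((n:ℝ) + 2) * t * A :=
    (mul_le_mul_of_nonneg_right e1 (abs_nonneg _)).trans e2
  have e4 : t * |pdn k.succ w (Fin.cons t x)| ≤ 4 * ((n:ℝ) + 2) * A := by
    apply le_of_mul_le_mul_left _ ht
    nlinarith
  have e5 := pow_le_pow_left₀ (by positivity) e4 2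
  rw [mul_pow, sq_abs] at e5
  calc _ ≤ _ := e5
    _ = _ := by ring

theorem dir_bound {n : ℕ} (w : (Fin (n+1) → ℝ) → ℝ) (y : Fin (n+1) → ℝ) (v : Fin n → ℝ)
    (hvI : v ∈ Icc (0 : Fin n → ℝ) 1) :
    fderiv ℝ w y (Fin.cons 0 v) ^ 2 ≤ n * ∑ k : Fin n, pdn k.succ w y ^ 2 := by
  rw [fderiv_cons_sum]
  refine (sq_sum_le_card_mul_sum_sq).trans ?_
  simp only [Finset.card_univ, Fintype.card_fin]
  refine mul_le_mul_of_nonneg_left (Finset.sum_le_sum fun k _ => ?_) (by positivity)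
  simp only [mul_pow]
  apply mul_le_of_le_one_left (by positivity)
  exact pow_le_one₀ (hvI.1 k) (hvI.2 k)

theorem region_one (n : ℕ) (hn : 2 ≤ n) (R : ℝ) (hR : 0 < R) : ∃ C > (0:ℝ), ∀
    (φ : (Fin (n+1) → ℝ) → ℝ), ContDiff ℝ (⊤ : ℕ∞) φ →
    (∀ t : ℝ, 0 < t → ∀ x : Fin n → ℝ, t + R ≤ radn x → φ (Fin.cons t x) = 0) →
    ∀ t : ℝ, 0 < t → t ≤ 1 → ∀ (x : Fin n → ℝ),
    φ (Fin.cons t x) ^ 2 ≤ C * Den n φ t := by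
  have hn0 : (0:ℝ) < n := by exact_mod_cast (by omega : 0 < n)
  obtain ⟨C, hC, H⟩ := region_int n hn (n * n) (by positivity)
  refine ⟨C * ((1 + R) ^ 2 + 1), by positivity, ?_⟩
  intro φ hφ hv t ht ht1 x
  have := H R φ hφ hv t ht x 1 one_pos (by
    intro w hw v hvI τ hτ
    rw [one_pow, one_mul]
    refine (dir_bound w _ v hvI).trans ?_
    rw [mul_assoc]
    refine mul_le_mul_of_nonneg_left ?_ hn0.le
    refine (Finset.sum_le_sum fun (k : Fin n) _ => Finset.single_le_sum
      (f := fun i => Zopn i w (Fin.cons t (x + (τ ^ 2 * 1) • v)) ^ 2)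
      (fun i _ => sq_nonneg _) (Finset.mem_univ (Sum.inl k.succ))).trans ?_
    rw [Finset.sum_const, Finset.card_univ, Fintype.card_fin, nsmul_eq_mul])
  rw [one_pow, one_mul, one_pow] at this
  refine this.trans ?_
  have hD : 0 ≤ Den n φ t := sumL_nonneg fun l => Finset.sum_nonneg fun k _ =>
    integral_nonneg fun z => by positivity
  gcongr

theorem region_two (n : ℕ) (hn : 2 ≤ n) (R : ℝ) (hR : 0 < R) : ∃ C > (0:ℝ), ∀
    (φ : (Fin (n+1) → ℝ) → ℝ), ContDiff ℝ (⊤ : ℕ∞) φ →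
    (∀ t : ℝ, 0 < t → ∀ x : Fin n → ℝ, t + R ≤ radn x → φ (Fin.cons t x) = 0) →
    ∀ t : ℝ, 1 < t → ∀ (x : Fin n → ℝ), radn x ≤ t / 2 →
    t ^ n * φ (Fin.cons t x) ^ 2 ≤ C * t ^ 2 * Den n φ t := by
  have hn0 : (0:ℝ) < n := by exact_mod_cast (by omega : 0 < n)
  have hn1 : (1:ℝ) ≤ n := by exact_mod_cast (by omega : 1 ≤ n)
  obtain ⟨C, hC, H⟩ := region_int n hn (n * (n * (16 * ((n:ℝ) + 2) ^ 2))) (by positivity)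
  refine ⟨(4 * n) ^ n * (C * ((1 + R) ^ 2 + 1)), by positivity, ?_⟩
  intro φ hφ hv t ht1 x hx
  have ht : 0 < t := by linarith
  have hct : t / (4 * n) ≤ t := div_le_self ht.le (by linarith)
  have := H R φ hφ hv t ht x (t / (4 * n)) (by positivity) (by
    intro w hw v hvI τ hτ
    have hxx : radn (x + (τ ^ 2 * (t / (4 * n))) • v) ≤ 3 / 4 * t := by
      refine (radn_add_le _ _).trans ?_
      rw [radn_smul, abs_of_nonneg (by positivity)]
      have h1 : radn v ≤ n * 1 := radn_le_of v 1 zero_le_one fun i => by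
        rw [abs_of_nonneg (hvI.1 i)]; exact hvI.2 i
      have h2 : τ ^ 2 ≤ 1 := pow_le_one₀ hτ.1 hτ.2
      have : τ ^ 2 * (t / (4 * n)) * radn v ≤ 1 * (t / (4 * n)) * (n * 1) := by
        gcongr
        exact radn_nonneg _
      have h3 : 1 * (t / (4 * n)) * (n * 1) = t / 4 := by field_simp
      linarith
    set y := x + (τ ^ 2 * (t / (4 * n))) • v
    calc _ ≤ t ^ 2 * (n * ∑ k : Fin n, pdn k.succ w (Fin.cons t y) ^ 2) := by
          gcongr
          exact dir_bound w _ v hvI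
      _ = n * ∑ k : Fin n, t ^ 2 * pdn k.succ w (Fin.cons t y) ^ 2 := by
          rw [Finset.mul_sum, Finset.mul_sum, Finset.mul_sum]
          refine Finset.sum_congr rfl fun k _ => by ring
      _ ≤ n * ∑ k : Fin n, 16 * ((n:ℝ) + 2) ^ 2 * ∑ i, Zopn i w (Fin.cons t y) ^ 2 :=
          mul_le_mul_of_nonneg_left (Finset.sum_le_sum fun k _ => cone_int_bound w t ht y hxx k)
            hn0.le
      _ = _ := by simp; ring)
  have hD : 0 ≤ Den n φ t := sumL_nonneg fun l => Finset.sum_nonneg fun k _ =>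
    integral_nonneg fun z => by positivity
  have h2 : (t + R) ^ 2 + (t / (4 * n)) ^ 2 ≤ ((1 + R) ^ 2 + 1) * t ^ 2 := by
    have h3 : (t + R) ^ 2 ≤ ((1 + R) * t) ^ 2 := by
      apply pow_le_pow_left₀ (by positivity)
      nlinarith
    have h4 : (t / (4 * n)) ^ 2 ≤ t ^ 2 := pow_le_pow_left₀ (by positivity) hct 2
    nlinarith
  have h5 : t ^ n = (4 * n) ^ n * (t / (4 * n)) ^ n := by
    rw [← mul_pow]; congr 1; field_simp
  rw [h5]
  calc _ = (4 * n) ^ n * ((t / (4 * n)) ^ n * φ (Fin.cons t x) ^ 2) := by ring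
    _ ≤ (4 * n) ^ n * (C * ((t + R) ^ 2 + (t / (4 * n)) ^ 2) * Den n φ t) := by gcongr
    _ ≤ (4 * n) ^ n * (C * (((1 + R) ^ 2 + 1) * t ^ 2) * Den n φ t) := by gcongr
    _ = _ := by ring

theorem rot_vec {n : ℕ} (t r q : ℝ) (hq : 0 < q) (f f' : Fin n → ℝ) (hqf : ∑ i, f i ^ 2 = q ^ 2) :
    (Fin.cons 0 ((r / q) • (f' - ((∑ i, f i * f' i) / q ^ 2) • f)) : Fin (n+1) → ℝ) =
      (1 / q ^ 2) • ∑ i, ∑ j, (f i * f' j) •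
        KVFn (Sum.inr (Sum.inl (i, j))) (Fin.cons t ((r / q) • f) : Fin (n+1) → ℝ) := by
  ext k
  refine Fin.cases ?_ (fun k => ?_) k
  · simp [KVFn, Finset.sum_apply]
  · simp only [Fin.cons_succ, Pi.smul_apply, Pi.sub_apply, smul_eq_mul, Finset.sum_apply, KVFn,
      mul_sub, Finset.sum_sub_distrib]
    have h1 : ∑ i : Fin n, ∑ j : Fin n, f i * f' j * (Pi.single (M := fun _ => ℝ) j.succ (r / q * f i) k.succ)
        = r / q * f' k * ∑ i, f i ^ 2 := by
      rw [Finset.mul_sum]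
      refine Finset.sum_congr rfl fun i _ => ?_
      rw [Finset.sum_eq_single k]
      · simp; ring
      · intro b _ hb
        rw [Pi.single_eq_of_ne (by simpa using hb.symm), mul_zero]
      · simp
    have h2 : ∑ i : Fin n, ∑ j : Fin n, f i * f' j * (Pi.single (M := fun _ => ℝ) i.succ (r / q * f j) k.succ)
        = r / q * f k * ∑ j, f j * f' j := by
      rw [Finset.sum_comm, Finset.mul_sum]
      refine Finset.sum_congr rfl fun i _ => ?_
      rw [Finset.sum_eq_single k]
      · simp; ring
      · intro b _ hb
        rw [Pi.single_eq_of_ne (by simpa using hb.symm), mul_zero]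
      · simp
    rw [h1, h2, hqf]
    field_simp

theorem rot_bound {n : ℕ} (w : (Fin (n+1) → ℝ) → ℝ) (t r τ : ℝ) (hτ : 0 ≤ τ) (f f' : Fin n → ℝ)
    (hq : 1 ≤ radn f) (hf' : ∀ j, |f' j| ≤ 2 * τ) :
    (fderiv ℝ w (Fin.cons t ((r / radn f) • f))
      (Fin.cons 0 ((r / radn f) • (f' - ((∑ i, f i * f' i) / radn f ^ 2) • f)))) ^ 2 ≤
    τ ^ 2 * (4 * n ^ 4 * ∑ i, Zopn i w (Fin.cons t ((r / radn f) • f)) ^ 2) := by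
  have hfq := abs_le_radn f
  rw [rot_vec t r (radn f) (by linarith) f f' (radn_sq f).symm]
  simp only [map_smul, map_sum, smul_eq_mul]
  set y : Fin (n+1) → ℝ := Fin.cons t ((r / radn f) • f)
  set q := radn f
  have hA := Z_abs_le w y
  have hs : Real.sqrt (∑ i, Zopn i w y ^ 2) ^ 2 = ∑ i, Zopn i w y ^ 2 :=
    Real.sq_sqrt (by positivity)
  have hA0 : 0 ≤ Real.sqrt (∑ i, Zopn i w y ^ 2) := Real.sqrt_nonneg _
  set A := Real.sqrt (∑ i, Zopn i w y ^ 2)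
  rw [← hs]
  have h1 : |∑ i, ∑ j, f i * f' j * fderiv ℝ w y (KVFn (Sum.inr (Sum.inl (i, j))) y)| ≤
      ∑ i : Fin n, ∑ j : Fin n, q * (2 * τ) * A := by
    refine (Finset.abs_sum_le_sum_abs _ _).trans (Finset.sum_le_sum fun i _ => ?_)
    refine (Finset.abs_sum_le_sum_abs _ _).trans (Finset.sum_le_sum fun j _ => ?_)
    rw [abs_mul, abs_mul]
    have := hfq i
    have := hf' j
    have := hA (Sum.inr (Sum.inl (i, j)))
    gcongr
  have h2 : |1 / q ^ 2 * ∑ i, ∑ j, f i * f' j * fderiv ℝ w y (KVFn (Sum.inr (Sum.inl (i, j))) y)| ≤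
      2 * n ^ 2 * τ * A := by
    rw [abs_mul, abs_of_nonneg (by positivity)]
    refine (mul_le_mul_of_nonneg_left h1 (by positivity)).trans ?_
    simp only [Finset.sum_const, Finset.card_univ, Fintype.card_fin, nsmul_eq_mul]
    rw [div_mul_eq_mul_div, div_le_iff₀ (by positivity)]
    have h3 : q ≤ q ^ 2 := by nlinarith
    have h4 : 0 ≤ 2 * n ^ 2 * τ * A := by positivity
    nlinarith [mul_le_mul_of_nonneg_left h3 h4]
  have h5 := pow_le_pow_left₀ (abs_nonneg _) h2 2
  rw [sq_abs] at h5
  refine h5.trans (le_of_eq ?_)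
  ring

theorem rot_path_deriv {n : ℕ} (t r : ℝ) (f f' : ℝ → Fin n → ℝ) (hf : ∀ τ, HasDerivAt f (f' τ) τ)
    (hq : ∀ τ, 1 ≤ radn (f τ)) (τ : ℝ) :
    HasDerivAt (fun τ => (Fin.cons t ((r / radn (f τ)) • f τ) : Fin (n+1) → ℝ))
      (Fin.cons 0 ((r / radn (f τ)) • (f' τ - ((∑ i, f τ i * f' τ i) / radn (f τ) ^ 2) • f τ))) τ := by
  have hfi : ∀ i, HasDerivAt (fun τ => f τ i) (f' τ i) τ := fun i => (hasDerivAt_pi.1 (hf τ)) i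
  have hq0 : 0 < radn (f τ) := by linarith [hq τ]
  have hr : HasDerivAt (fun τ => radn (f τ)) ((∑ i, f τ i * f' τ i) / radn (f τ)) τ := by
    have h1 : HasDerivAt (fun τ => ∑ i, f τ i ^ 2) (∑ i, 2 * f τ i * f' τ i) τ := by
      have := HasDerivAt.fun_sum (u := Finset.univ) fun i _ => (hfi i).pow 2
      simpa using this
    have h2 := h1.sqrt (by rw [← radn_sq]; positivity)
    refine h2.congr_deriv ?_
    rw [show √(∑ i, f τ i ^ 2) = radn (f τ) from rfl]
    simp only [mul_assoc]
    rw [← Finset.mul_sum]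
    field_simp
  rw [hasDerivAt_pi]
  intro i
  refine Fin.cases ?_ (fun i => ?_) i
  · simpa using hasDerivAt_const τ t
  · have h3 := ((hasDerivAt_const τ r).div hr hq0.ne').mul (hfi i)
    simp only [Fin.cons_succ, Pi.smul_apply, Pi.sub_apply, smul_eq_mul]
    refine h3.congr_deriv ?_
    simp only [Pi.div_apply]
    field_simp
    ring

theorem ray_cs (h h' : ℝ → ℝ) (hd : ∀ x, HasDerivAt h (h' x) x) (hc : Continuous h') (a b : ℝ)
    (hab : a < b) (hb : h b = 0) : h a ^ 2 ≤ (b - a) * ∫ x in a..b, h' x ^ 2 := by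
  have h1 : ∫ x in a..b, h' x = - h a := by
    rw [intervalIntegral.integral_eq_sub_of_hasDerivAt (fun x _ => hd x) (hc.intervalIntegrable _ _),
      hb, zero_sub]
  have hδ : 0 < b - a := by linarith
  have h2 : 0 ≤ ∫ x in a..b, (h' x + h a / (b - a)) ^ 2 :=
    intervalIntegral.integral_nonneg hab.le fun x _ => sq_nonneg _
  have h3 : ∫ x in a..b, (h' x + h a / (b - a)) ^ 2 =
      (∫ x in a..b, h' x ^ 2) + (2 * (h a / (b - a))) * (∫ x in a..b, h' x)
        + (b - a) * (h a / (b - a)) ^ 2 := by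
    rw [← intervalIntegral.integral_const_mul, ← intervalIntegral.integral_add,
      ← smul_eq_mul (b - a), ← intervalIntegral.integral_const, ← intervalIntegral.integral_add]
    · congr 1; ext x; ring
    all_goals exact Continuous.intervalIntegrable (by fun_prop) _ _
  rw [h3, h1] at h2
  have h4 : (∫ x in a..b, h' x ^ 2) + (2 * (h a / (b - a))) * (- h a)
        + (b - a) * (h a / (b - a)) ^ 2 = (∫ x in a..b, h' x ^ 2) - h a ^ 2 / (b - a) := by
    field_simp; ring
  rw [h4, sub_nonneg, div_le_iff₀ hδ] at h2
  linarith

theorem ray_bound {n : ℕ} {u : (Fin n → ℝ) → ℝ} (hu : ContDiff ℝ (⊤ : ℕ∞) u) {ρ : ℝ}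
    (h : ∀ x, ρ < radn x → u x = 0) (Q : Fin n → ℝ) (hQ : 0 < radn Q) (r0 ρ1 : ℝ) (h1 : r0 < ρ1)
    (h2 : ρ < ρ1) (hρ1 : 0 < ρ1) :
    u ((r0 / radn Q) • Q) ^ 2 ≤ (ρ1 - r0) * radn Q *
      ∫ s in (r0 / radn Q)..(ρ1 / radn Q), ∑ k, pdn k u (s • Q) ^ 2 := by
  have hd : ∀ s : ℝ, HasDerivAt (fun s : ℝ => u (s • Q)) (fderiv ℝ u (s • Q) Q) s := fun s => by
    have := (hu.differentiable (by simp) (s • Q)).hasFDerivAt.comp_hasDerivAt s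
      ((hasDerivAt_id s).smul_const Q)
    rw [one_smul] at this
    exact this
  have hQc : Continuous fun s : ℝ => s • Q := by fun_prop
  have hc : Continuous fun s : ℝ => fderiv ℝ u (s • Q) Q :=
    ((fderiv_contDiff_top hu).continuous.comp hQc).clm_apply continuous_const
  have hpc : ∀ k, Continuous fun s : ℝ => pdn k u (s • Q) := fun k =>
    (pdn_contDiff k hu).continuous.comp hQc
  have hlt : r0 / radn Q < ρ1 / radn Q := by gcongr
  have h3 := ray_cs _ _ hd hc _ _ hlt (by
    apply h
    rw [radn_smul, abs_of_pos (by positivity)]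
    field_simp
    exact h2)
  refine h3.trans ?_
  have h4 : ∫ s in (r0 / radn Q)..(ρ1 / radn Q), (fderiv ℝ u (s • Q) Q) ^ 2 ≤
      ∫ s in (r0 / radn Q)..(ρ1 / radn Q), radn Q ^ 2 * ∑ k, pdn k u (s • Q) ^ 2 := by
    apply intervalIntegral.integral_mono_on hlt.le
    · exact Continuous.intervalIntegrable (by fun_prop) _ _
    · exact Continuous.intervalIntegrable (by fun_prop) _ _
    · intro s _
      have hQs : Q = ∑ k, Q k • (Pi.single k 1 : Fin n → ℝ) := by
        ext i; simp [Finset.sum_apply, Pi.single_apply]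
      have h5 : fderiv ℝ u (s • Q) Q = ∑ k, Q k * pdn k u (s • Q) := by
        conv_lhs => rw [hQs]
        rw [map_sum, ← hQs]
        simp [pdn]
      rw [h5, radn_sq]
      exact Finset.sum_mul_sq_le_sq_mul_sq _ _ _
  rw [intervalIntegral.integral_const_mul] at h4
  refine (mul_le_mul_of_nonneg_left h4 (by linarith)).trans (le_of_eq ?_)
  field_simp

theorem polar_tonelli {m : ℕ} (i0 : Fin (m+1)) (σ : ℝ) (hσ : σ = 1 ∨ σ = -1)
    (G : (Fin (m+1) → ℝ) → ENNReal) (hG : Measurable G) (a : ℝ) (ha : 0 < a) :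
    ∫⁻ θ : Fin m → ℝ, ∫⁻ s in Ioi a, G (s • (i0.insertNth σ θ : Fin (m+1) → ℝ)) ≤
      ENNReal.ofReal ((a ^ m)⁻¹) * ∫⁻ z, G z := by
  have hins : Measurable fun p : ℝ × (Fin m → ℝ) => (i0.insertNth p.1 p.2 : Fin (m+1) → ℝ) :=
    Continuous.measurable (by
      exact Continuous.finInsertNth i0 continuous_fst continuous_snd)
  have hsm : ∀ (s : ℝ) (θ : Fin m → ℝ), s • (i0.insertNth σ θ : Fin (m+1) → ℝ) =
      i0.insertNth (σ * s) (s • θ) := by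
    intro s θ
    ext j
    refine i0.succAboveCases ?_ (fun j => ?_) j
    · simp [mul_comm]
    · simp
  have hm1 : Measurable fun p : (Fin m → ℝ) × ℝ => G (i0.insertNth (σ * p.2) (p.2 • p.1)) :=
    hG.comp (hins.comp (f := fun p : (Fin m → ℝ) × ℝ => (σ * p.2, p.2 • p.1)) (by fun_prop))
  have hm2 : Measurable fun s : ℝ => ∫⁻ y : Fin m → ℝ, G (i0.insertNth s y) :=
    (hG.comp hins).lintegral_prod_right'
  simp only [hsm]
  rw [lintegral_lintegral_swap (by exact hm1.aemeasurable)]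
  have h1 : ∀ s ∈ Ioi a, ∫⁻ θ : Fin m → ℝ, G (i0.insertNth (σ * s) (s • θ)) ≤
      ENNReal.ofReal ((a ^ m)⁻¹) * ∫⁻ y : Fin m → ℝ, G (i0.insertNth (σ * s) y) := by
    intro s hs
    have hs' : a < s := hs
    have := lint_affine m (fun y => G (i0.insertNth (σ * s) y))
      (hG.comp (hins.comp (f := fun y : Fin m → ℝ => (σ * s, y)) (by fun_prop))) 0 s (ha.trans hs')
    simp only [zero_add] at this
    rw [this]
    gcongr
  refine (setLIntegral_mono' measurableSet_Ioi h1).trans ?_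
  refine (setLIntegral_le_lintegral _ _).trans ?_
  rw [lintegral_const_mul]
  swap
  · exact hm2.comp (measurable_const_mul σ)
  gcongr
  have h3 : ∫⁻ s : ℝ, ∫⁻ y : Fin m → ℝ, G (i0.insertNth (σ * s) y) =
      ∫⁻ s : ℝ, ∫⁻ y : Fin m → ℝ, G (i0.insertNth s y) := by
    rcases hσ with rfl | rfl
    · simp
    · simp only [neg_one_mul]
      exact lintegral_neg_eq_self (μ := volume) (fun s : ℝ => ∫⁻ y : Fin m → ℝ, G (i0.insertNth s y))
  rw [h3]
  have h4 := (volume_preserving_piFinSuccAbove (fun _ : Fin (m+1) => ℝ) i0).symm.lintegral_comp hG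
  rw [← h4]
  rw [Measure.volume_eq_prod, lintegral_prod]
  · rfl
  · exact (hG.comp hins).aemeasurable

theorem region_polar (m : ℕ) (R : ℝ) (hR : 0 < R) : ∃ C > (0:ℝ), ∀
    (φ : (Fin (m+1+1) → ℝ) → ℝ), ContDiff ℝ (⊤ : ℕ∞) φ →
    (∀ t : ℝ, 0 < t → ∀ x : Fin (m+1) → ℝ, t + R ≤ radn x → φ (Fin.cons t x) = 0) →
    ∀ t : ℝ, 1 < t → ∀ (i0 : Fin (m+1)) (σ : ℝ), (σ = 1 ∨ σ = -1) → ∀ θ0 : Fin m → ℝ,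
    (∀ j, |θ0 j| ≤ 1) → ∀ r0 : ℝ, t / 2 < r0 → r0 < t + R →
    t ^ m * φ (Fin.cons t ((r0 / radn (i0.insertNth σ θ0 : Fin (m+1) → ℝ)) •
      (i0.insertNth σ θ0 : Fin (m+1) → ℝ))) ^ 2 ≤ C * (t + R + 1 - r0) * Den (m+1) φ t := by
  obtain ⟨C1, hC1, H1⟩ := path_P (m+1) (m/2) (4 * ((m+1 : ℕ):ℝ) ^ 4) (by positivity)
  refine ⟨(4 * ((m+1 : ℕ):ℝ)) ^ m * (C1 * (2 * ((m+1 : ℕ):ℝ))), by positivity, ?_⟩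
  intro φ hφ hv t ht1 i0 σ hσ θ0 hθ0 r0 hr0 hr1
  have ht : 0 < t := by linarith
  set N : ℝ := ((m+1 : ℕ):ℝ) with hN
  have hN0 : 0 < N := by positivity
  set Q : (Fin m → ℝ) → (Fin (m+1) → ℝ) := fun θ => i0.insertNth σ θ with hQ
  have hσ1 : |σ| = 1 := by rcases hσ with h | h <;> simp [h]
  have hQ1 : ∀ θ, 1 ≤ radn (Q θ) := fun θ => by
    have := abs_le_radn (Q θ) i0
    simpa [hQ, hσ1] using this
  have hQc : Continuous Q := Continuous.finInsertNth i0 continuous_const continuous_id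
  set s := m/2+1 with hs
  set W : List (KIdx (m+1)) → (Fin (m+1) → ℝ) → ℝ := fun l z => Zitn l φ (Fin.cons t z) with hW
  have hWs : ∀ l, ContDiff ℝ (⊤ : ℕ∞) (W l) := fun l => (Zitn_contDiff hφ l).comp (cons_contDiff t)
  set P : List (KIdx (m+1)) → (Fin (m+1) → ℝ) → ℝ := fun l z =>
    ∑ k : Fin (m+1), pdn k (W l) z ^ 2 with hP
  have hWc : ∀ l, Continuous (W l) := fun l => (hWs l).continuous
  have hPc : ∀ l, Continuous (P l) := fun l =>
    continuous_finsetSum _ fun k _ => (pdn_contDiff k (hWs l)).continuous.pow 2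
  have hP0 : ∀ l z, 0 ≤ P l z := fun l z => by positivity
  set Ψ : (Fin (m+1) → ℝ) → ℝ := fun z => sumL (m+1) s fun l => P l z with hΨ
  have hΨc : Continuous Ψ := sumL_continuous (f := fun l z => P l z) hPc
  have hΨ0 : ∀ z, 0 ≤ Ψ z := fun z => sumL_nonneg fun l => hP0 l z
  set X : (Fin m → ℝ) → (Fin (m+1) → ℝ) := fun θ => (r0 / radn (Q θ)) • Q θ with hX
  have hXc : Continuous X := by
    refine Continuous.smul (continuous_const.div (radn_continuous.comp hQc) fun θ => ?_) hQc
    have := hQ1 θ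
    simp only [Function.comp]
    linarith
  set g : (Fin m → ℝ) → ℝ := fun θ => C1 * sumL (m+1) s fun l => W l (X θ) ^ 2 with hg
  have hgc : Continuous g := continuous_const.mul
    (sumL_continuous (f := fun l θ => W l (X θ) ^ 2) fun l => ((hWc l).comp hXc).pow 2)
  have hg0 : ∀ z, 0 ≤ g z := fun z =>
    mul_nonneg hC1.le (sumL_nonneg fun l => sq_nonneg _)
  have havg := avg_real m (4 * (m/2) + 2) (by omega) g hgc hg0 (Icc (-2) 2) measurableSet_Icc
    θ0 1 one_pos (φ (Fin.cons t (X θ0)) ^ 2) (by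
      intro v hvI τ hτ
      have h2 : τ ^ 2 ≤ 1 := pow_le_one₀ hτ.1 hτ.2
      have h3 : ∀ j, |(θ0 + (τ ^ 2 * 1) • v) j| ≤ 2 := fun j => by
        have e1 := abs_le.1 (hθ0 j)
        have e2 : 0 ≤ v j := hvI.1 j
        have e3 : v j ≤ 1 := hvI.2 j
        have e4 : τ ^ 2 * v j ≤ 1 := mul_le_one₀ h2 e2 e3
        have e5 : 0 ≤ τ ^ 2 * v j := by positivity
        simp only [Pi.add_apply, Pi.smul_apply, smul_eq_mul, mul_one]
        rw [abs_le]; constructor <;> linarith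
      exact ⟨fun j => (abs_le.1 (h3 j)).1, fun j => (abs_le.1 (h3 j)).2⟩) (by
      intro v hvI
      have hf : ∀ τ : ℝ, HasDerivAt (fun τ : ℝ => Q (θ0 + (τ ^ 2 * 1) • v))
          (i0.insertNth 0 ((2 * τ) • v) : Fin (m+1) → ℝ) τ := by
        intro τ
        rw [hasDerivAt_pi]
        intro i
        refine i0.succAboveCases ?_ (fun j => ?_) i
        · simpa [hQ] using hasDerivAt_const τ σ
        · have := ((((hasDerivAt_pow 2 τ).mul_const 1).mul_const (v j)).const_add (θ0 j))
          simpa [hQ] using this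
      have hp := rot_path_deriv t r0 _ _ hf (fun τ => hQ1 _)
      have hfc : Continuous (fun τ : ℝ => Q (θ0 + (τ ^ 2 * 1) • v)) := hQc.comp (by fun_prop)
      have hf'c : Continuous (fun τ : ℝ => (i0.insertNth 0 ((2 * τ) • v) : Fin (m+1) → ℝ)) :=
        Continuous.finInsertNth i0 continuous_const (by fun_prop)
      have hrc : Continuous (fun τ : ℝ => radn (Q (θ0 + (τ ^ 2 * 1) • v))) :=
        radn_continuous.comp hfc
      have hne : ∀ τ : ℝ, radn (Q (θ0 + (τ ^ 2 * 1) • v)) ≠ 0 := fun τ => by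
        have := hQ1 (θ0 + (τ ^ 2 * 1) • v)
        linarith
      have h1 := H1 φ hφ _ _ hp (by
        have hz : Continuous fun z : Fin (m+1) → ℝ => (Fin.cons 0 z : Fin (m+1+1) → ℝ) :=
          cons_continuous 0
        refine hz.comp ?_
        refine (continuous_const.div hrc hne).smul (hf'c.sub (Continuous.smul (Continuous.div ?_
          (hrc.pow 2) fun τ => pow_ne_zero 2 (hne τ)) hfc))
        exact continuous_finsetSum _ fun i _ =>
          ((continuous_apply i).comp hfc).mul ((continuous_apply i).comp hf'c)) (by
        intro w hw τ hτ
        refine rot_bound w t r0 τ hτ.1 _ _ (hQ1 _) ?_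
        intro j
        have hτ0 := hτ.1
        refine i0.succAboveCases ?_ (fun j => ?_) j
        · simp [hτ0]
        · simp only [Fin.insertNth_apply_succAbove, Pi.smul_apply, smul_eq_mul]
          have e2 : 0 ≤ v j := hvI.1 j
          have e3 : v j ≤ 1 := hvI.2 j
          rw [abs_of_nonneg (by positivity)]
          nlinarith)
      simp only [zero_pow, ne_eq, OfNat.ofNat_ne_zero, not_false_eq_true, zero_mul, zero_smul,
        add_zero] at h1
      refine h1.trans (le_of_eq ?_)
      congr 1
      ext τ
      simp only [hg, hX, hW]
      ring)
  have hpt : ∀ θ ∈ Icc (-2 : Fin m → ℝ) 2, ENNReal.ofReal (g θ) ≤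
      ENNReal.ofReal (C1 * ((t + R + 1 - r0) * (N * 2))) *
        ∫⁻ u in Ioi (t / (4 * N)), ENNReal.ofReal (Ψ (u • Q θ)) := by
    intro θ hθ
    have hq2 : radn (Q θ) ≤ N * 2 := radn_le_of _ 2 (by norm_num) fun i => by
      refine i0.succAboveCases ?_ (fun j => ?_) i
      · simp [hQ, hσ1]
      · simp only [hQ, Fin.insertNth_apply_succAbove]
        exact abs_le.2 ⟨hθ.1 j, hθ.2 j⟩
    have hq1 := hQ1 θ
    have hq0 : 0 < radn (Q θ) := by linarith
    have hle : r0 / radn (Q θ) ≤ (t + R + 1) / radn (Q θ) := by gcongr; linarith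
    have hsum := list_int_sum' (kLists (m+1) s) (f := fun l (u : ℝ) => P l (u • Q θ))
      (μ := volume.restrict (Ioc (r0 / radn (Q θ)) ((t + R + 1) / radn (Q θ)))) (fun l => by
        have : Continuous fun u : ℝ => P l (u • Q θ) := (hPc l).comp (by fun_prop)
        exact (this.integrableOn_Icc).mono_set Ioc_subset_Icc_self)
    have hgle : g θ ≤ C1 * ((t + R + 1 - r0) * (N * 2)) *
        ∫ u in Ioc (r0 / radn (Q θ)) ((t + R + 1) / radn (Q θ)), Ψ (u • Q θ) := by
      have e1 : sumL (m+1) s (fun l => W l (X θ) ^ 2) ≤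
          sumL (m+1) s fun l => ((t + R + 1 - r0) * radn (Q θ)) *
            ∫ u in Ioc (r0 / radn (Q θ)) ((t + R + 1) / radn (Q θ)), P l (u • Q θ) := by
        apply List.sum_le_sum
        intro l _
        have := ray_bound (hWs l) (ρ := t + R) (fun x hx => Zitn_vanish hv l _ (by simpa using ht)
          (by simpa using hx)) (Q θ) hq0 r0 (t + R + 1) (by linarith) (by linarith) (by linarith)
        rw [intervalIntegral.integral_of_le hle] at this
        exact this
      rw [sumL_mul] at e1
      have e2 : ∫ u in Ioc (r0 / radn (Q θ)) ((t + R + 1) / radn (Q θ)), Ψ (u • Q θ) =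
        sumL (m+1) s fun l =>
          ∫ u in Ioc (r0 / radn (Q θ)) ((t + R + 1) / radn (Q θ)), P l (u • Q θ) := hsum.2
      rw [← e2] at e1
      have e3 : 0 ≤ ∫ u in Ioc (r0 / radn (Q θ)) ((t + R + 1) / radn (Q θ)), Ψ (u • Q θ) :=
        integral_nonneg fun u => hΨ0 _
      have e4 : 0 ≤ t + R + 1 - r0 := by linarith
      calc g θ ≤ C1 * (((t + R + 1 - r0) * radn (Q θ)) *
            ∫ u in Ioc (r0 / radn (Q θ)) ((t + R + 1) / radn (Q θ)), Ψ (u • Q θ)) :=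
            mul_le_mul_of_nonneg_left e1 hC1.le
        _ ≤ C1 * (((t + R + 1 - r0) * (N * 2)) *
            ∫ u in Ioc (r0 / radn (Q θ)) ((t + R + 1) / radn (Q θ)), Ψ (u • Q θ)) := by
            gcongr
        _ = _ := by ring
    refine (ENNReal.ofReal_le_ofReal hgle).trans ?_
    have e4 : 0 ≤ t + R + 1 - r0 := by linarith
    rw [ENNReal.ofReal_mul (by positivity)]
    gcongr
    rw [ofReal_integral_eq_lintegral_ofReal (f := fun u : ℝ => Ψ (u • Q θ)) hsum.1 (Filter.Eventually.of_forall fun u => hΨ0 _)]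
    apply lintegral_mono_set
    refine Ioc_subset_Ioi_self.trans (Ioi_subset_Ioi ?_)
    rw [div_le_div_iff₀ (by positivity) hq0]
    nlinarith
  have hm := polar_tonelli i0 σ hσ (fun z => ENNReal.ofReal (Ψ z)) (by fun_prop) (t / (4 * N))
    (by positivity)
  have hfacts := fun l => slice_facts hφ hv l ht
  have hPe : ∀ l z, P l z = ∑ k : Fin (m+1), pdn k.succ (Zitn l φ) (Fin.cons t z) ^ 2 := fun l z => by
    simp only [hP, hW]
    refine Finset.sum_congr rfl fun k _ => ?_
    rw [slice_pdn (Zitn_contDiff hφ l)]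
  have hPI : ∀ l, Integrable (P l) := fun l => by
    have : P l = fun z => ∑ k : Fin (m+1), pdn k.succ (Zitn l φ) (Fin.cons t z) ^ 2 :=
      funext (hPe l)
    rw [this]
    exact integrable_finsetSum _ fun k _ => (hfacts l).2.1 k
  have hsI := list_int_sum' (kLists (m+1) s) (f := P) (μ := volume) hPI
  have hDen : ∫ z, Ψ z = Den (m+1) φ t := by
    refine hsI.2.trans ?_
    unfold Den sumL
    simp only [Nat.add_sub_cancel, ← hs]
    congr 2
    ext l
    rw [← integral_finsetSum _ fun k _ => (hfacts l).2.1 k]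
    congr 1
    exact funext (hPe l)
  have hD0 : 0 ≤ Den (m+1) φ t := hDen ▸ integral_nonneg hΨ0
  rw [← ofReal_integral_eq_lintegral_ofReal (f := Ψ) hsI.1 (Filter.Eventually.of_forall hΨ0)] at hm
  have hm' : ∫⁻ θ : Fin m → ℝ, ∫⁻ u in Ioi (t / (4 * N)), ENNReal.ofReal (Ψ (u • Q θ)) ≤
      ENNReal.ofReal (((t / (4 * N)) ^ m)⁻¹ * Den (m+1) φ t) := by
    rw [ENNReal.ofReal_mul (by positivity), ← hDen]
    exact hm
  have e4 : 0 ≤ t + R + 1 - r0 := by linarith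
  have hfin : ENNReal.ofReal (φ (Fin.cons t (X θ0)) ^ 2) ≤
      ENNReal.ofReal (C1 * ((t + R + 1 - r0) * (N * 2)) * (((t / (4 * N)) ^ m)⁻¹ * Den (m+1) φ t)) := by
    refine havg.trans ?_
    rw [one_pow, inv_one, ENNReal.ofReal_one, one_mul]
    refine (setLIntegral_mono' measurableSet_Icc hpt).trans ?_
    refine (setLIntegral_le_lintegral _ _).trans ?_
    rw [lintegral_const_mul' _ _ ENNReal.ofReal_ne_top,
      ENNReal.ofReal_mul (p := C1 * ((t + R + 1 - r0) * (N * 2))) (by positivity)]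
    exact mul_le_mul_right hm' _
  rw [ENNReal.ofReal_le_ofReal_iff (by positivity)] at hfin
  have htm : 0 < t ^ m := by positivity
  calc _ ≤ t ^ m * (C1 * ((t + R + 1 - r0) * (N * 2)) * (((t / (4 * N)) ^ m)⁻¹ * Den (m+1) φ t)) := by
        gcongr
    _ = _ := by
        rw [div_pow]
        field_simp

theorem region_three (n : ℕ) (hn : 2 ≤ n) (R : ℝ) (hR : 0 < R) : ∃ C > (0:ℝ), ∀
    (φ : (Fin (n+1) → ℝ) → ℝ), ContDiff ℝ (⊤ : ℕ∞) φ →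
    (∀ t : ℝ, 0 < t → ∀ x : Fin n → ℝ, t + R ≤ radn x → φ (Fin.cons t x) = 0) →
    ∀ t : ℝ, 1 < t → ∀ (x : Fin n → ℝ), t / 2 < radn x → radn x < t + R →
    t ^ (n-1) * φ (Fin.cons t x) ^ 2 ≤ C * (t + R + 1 - radn x) * Den n φ t := by
  obtain ⟨m, rfl⟩ : ∃ m, n = m + 1 := ⟨n - 1, by omega⟩
  obtain ⟨C, hC, H⟩ := region_polar m R hR
  refine ⟨C, hC, ?_⟩
  intro φ hφ hv t ht x hx1 hx2
  obtain ⟨i0, -, hi0⟩ := Finset.exists_max_image Finset.univ (fun i => |x i|) Finset.univ_nonempty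
  set b := |x i0| with hb
  have hb0 : 0 < b := by
    by_contra! hc
    have := radn_le_of x 0 le_rfl fun i => (hi0 i (Finset.mem_univ i)).trans hc
    linarith
  obtain ⟨σ, hσ, hσb⟩ : ∃ σ : ℝ, (σ = 1 ∨ σ = -1) ∧ x i0 = b * σ := by
    rcases abs_choice (x i0) with h | h
    · exact ⟨1, Or.inl rfl, by rw [mul_one, hb, h]⟩
    · exact ⟨-1, Or.inr rfl, by rw [hb, h]; ring⟩
  have key : x = b • (i0.insertNth σ (fun j => x (i0.succAbove j) / b) : Fin (m+1) → ℝ) := by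
    ext i
    refine i0.succAboveCases ?_ (fun j => ?_) i
    · simp [hσb]
    · simp; field_simp
  have := H φ hφ hv t ht i0 σ hσ (fun j => x (i0.succAbove j) / b) (fun j => by
    rw [abs_div, abs_of_pos hb0]
    exact (div_le_one hb0).2 (hi0 _ (Finset.mem_univ _))) (radn x) hx1 hx2
  set Q : Fin (m+1) → ℝ := i0.insertNth σ (fun j => x (i0.succAbove j) / b)
  have hr : radn x = b * radn Q := by rw [key, radn_smul, abs_of_pos hb0]
  have hQ0 : radn Q ≠ 0 := by
    intro h
    rw [h] at hr
    linarith
  have h2 : radn x / radn Q = b := by rw [hr]; field_simp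
  rw [h2, ← key] at this
  exact this

theorem core_sq (n : ℕ) (hn : 2 ≤ n) (R : ℝ) (hR : 0 < R) : ∃ C > (0:ℝ), ∀
    (φ : (Fin (n+1) → ℝ) → ℝ), ContDiff ℝ (⊤ : ℕ∞) φ →
    (∀ t : ℝ, 0 < t → ∀ x : Fin n → ℝ, t + R ≤ radn x → φ (Fin.cons t x) = 0) →
    ∀ t : ℝ, 0 < t → ∀ (x : Fin n → ℝ),
    (1 + t) ^ (n-1) * φ (Fin.cons t x) ^ 2 ≤ C * (1 + |t - radn x|) * Den n φ t := by
  obtain ⟨C1, hC1, H1⟩ := region_one n hn R hR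
  obtain ⟨C2, hC2, H2⟩ := region_two n hn R hR
  obtain ⟨C3, hC3, H3⟩ := region_three n hn R hR
  refine ⟨2 ^ (n-1) * (C1 + C2 * 2 + C3 * (R + 1)), by positivity, ?_⟩
  intro φ hφ hv t ht x
  have hD : 0 ≤ Den n φ t := sumL_nonneg fun l => Finset.sum_nonneg fun k _ =>
    integral_nonneg fun z => by positivity
  have hA := abs_nonneg (t - radn x)
  have hA1 := le_abs_self (t - radn x)
  set A := |t - radn x|
  set D := Den n φ t
  set F := φ (Fin.cons t x) ^ 2 with hF
  have hF0 : 0 ≤ F := sq_nonneg _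
  have hC3' : 0 ≤ C3 * (R + 1) := by positivity
  have fin : ∀ c, 0 ≤ c → c ≤ C1 + C2 * 2 + C3 * (R + 1) → ∀ a, 0 ≤ a → (1 + t) ^ (n-1) ≤ 2 ^ (n-1) * a →
      a * F ≤ c * (1 + A) * D →
      (1 + t) ^ (n-1) * F ≤ 2 ^ (n-1) * (C1 + C2 * 2 + C3 * (R + 1)) * (1 + A) * D := by
    intro c hc0 hc a ha h1 h2
    calc (1 + t) ^ (n-1) * F ≤ 2 ^ (n-1) * a * F := by gcongr
      _ = 2 ^ (n-1) * (a * F) := by ring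
      _ ≤ 2 ^ (n-1) * (c * (1 + A) * D) := by gcongr
      _ ≤ 2 ^ (n-1) * ((C1 + C2 * 2 + C3 * (R + 1)) * (1 + A) * D) := by gcongr
      _ = _ := by ring
  have hpow : 1 < t → (1 + t) ^ (n-1) ≤ 2 ^ (n-1) * t ^ (n-1) := fun h => by
    rw [← mul_pow]
    exact pow_le_pow_left₀ (by positivity) (by linarith) _
  rcases le_or_gt t 1 with h1 | h1
  · refine fin C1 hC1.le (by linarith) 1 zero_le_one ?_ ?_
    · rw [mul_one]
      exact pow_le_pow_left₀ (by positivity) (by linarith) _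
    · rw [one_mul]
      refine (H1 φ hφ hv t ht h1 x).trans ?_
      have : 0 ≤ C1 * D := by positivity
      nlinarith
  rcases le_or_gt (radn x) (t / 2) with h2 | h2
  · refine fin (C2 * 2) (by positivity) (by linarith) (t ^ (n-1)) (by positivity) (hpow h1) ?_
    have h3 := H2 φ hφ hv t h1 x h2
    have h4 : t ^ n = t * t ^ (n-1) := by
      rw [← pow_succ']; congr 1; omega
    rw [h4] at h3
    have h5 : t ^ (n-1) * F ≤ C2 * t * D := by
      apply le_of_mul_le_mul_left _ ht
      calc _ = _ := by ring
        _ ≤ _ := h3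
        _ = _ := by ring
    refine h5.trans ?_
    rw [mul_assoc C2 2]
    gcongr
    linarith
  rcases lt_or_ge (radn x) (t + R) with h3 | h3
  · refine fin (C3 * (R + 1)) hC3' (by linarith) (t ^ (n-1)) (by positivity) (hpow h1) ?_
    refine (H3 φ hφ hv t h1 x h2 h3).trans ?_
    rw [mul_assoc C3 (R + 1)]
    gcongr
    nlinarith
  · have : F = 0 := by rw [hF, hv t ht x h3]; norm_num
    rw [this, mul_zero]
    positivity

theorem list_sq_le {ι : Type*} (L : List ι) (f g : ι → ℝ) (hg : ∀ l, 0 ≤ g l)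
    (h : ∀ l, f l ≤ g l ^ 2) : (L.map f).sum ≤ (L.map g).sum ^ 2 := by
  induction L with
  | nil => simp
  | cons a L ih =>
    simp only [List.map_cons, List.sum_cons]
    have h1 := h a
    have h2 := hg a
    have h3 : 0 ≤ (L.map g).sum := List.sum_nonneg (by
      simp only [List.mem_map]
      rintro _ ⟨l, _, rfl⟩
      exact hg l)
    nlinarith [mul_nonneg h2 h3]

/-- **Proposition A.1 (inequality (1.25) in general dimension).** For `n ≥ 2` and `R > 0`
there is `C = C(n,R) > 0` such that for smooth `φ` with `supp φ(t,·) ⊂ {|x| < t + R}`,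
`(1+t)^{(n-1)/2}(1+|t-r|)^{-1/2}|φ(t,x)| ≤ C Σ_{|a| ≤ [(n-1)/2]+1} ‖∂_x Z^a φ(t,·)‖_{L²}`. -/
theorem stmt13_weighted_decay_estimate (n : ℕ) (hn : 2 ≤ n) (R : ℝ) (hR : 0 < R) :
    ∃ C > (0 : ℝ),
      ∀ φ : (Fin (n + 1) → ℝ) → ℝ, ContDiff ℝ (⊤ : ℕ∞) φ →
        (∀ t : ℝ, 0 < t → ∀ x : Fin n → ℝ, t + R ≤ radn x → φ (Fin.cons t x) = 0) →
        ∀ t : ℝ, 0 < t → ∀ x : Fin n → ℝ,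
          (1 + t) ^ (((n : ℝ) - 1) / 2) * (1 + |t - radn x|) ^ (-(1 : ℝ) / 2)
              * |φ (Fin.cons t x)|
            ≤ C * ((kLists n ((n - 1) / 2 + 1)).map fun l =>
                ∑ k : Fin n, Real.sqrt
                  (∫ z : Fin n → ℝ, (pdn k.succ (Zitn l φ) (Fin.cons t z)) ^ 2)).sum := by
  obtain ⟨C, hC, H⟩ := core_sq n hn R hR
  refine ⟨Real.sqrt C, Real.sqrt_pos.2 hC, ?_⟩
  intro φ hφ hv t ht x
  have h1 := H φ hφ hv t ht x
  set T := ((kLists n ((n - 1) / 2 + 1)).map fun l =>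
    ∑ k : Fin n, Real.sqrt (∫ z : Fin n → ℝ, (pdn k.succ (Zitn l φ) (Fin.cons t z)) ^ 2)).sum with hT
  have hT0 : 0 ≤ T := List.sum_nonneg (by
    simp only [List.mem_map]
    rintro _ ⟨l, _, rfl⟩
    exact Finset.sum_nonneg fun k _ => Real.sqrt_nonneg _)
  have hDT : Den n φ t ≤ T ^ 2 := by
    refine list_sq_le _ _ _ (fun l => Finset.sum_nonneg fun k _ => Real.sqrt_nonneg _) fun l => ?_
    calc ∑ k : Fin n, ∫ z : Fin n → ℝ, (pdn k.succ (Zitn l φ) (Fin.cons t z)) ^ 2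
        = ∑ k : Fin n, Real.sqrt (∫ z : Fin n → ℝ, (pdn k.succ (Zitn l φ) (Fin.cons t z)) ^ 2) ^ 2 :=
          Finset.sum_congr rfl fun k _ =>
            (Real.sq_sqrt (integral_nonneg fun z => by positivity)).symm
      _ ≤ _ := Finset.sum_sq_le_sq_sum_of_nonneg fun k _ => Real.sqrt_nonneg _
  have hA : 0 < 1 + |t - radn x| := by positivity
  have ht1 : 0 < 1 + t := by linarith
  apply le_of_sq_le_sq _ (by positivity)
  have e1 : ((1 + t) ^ (((n : ℝ) - 1) / 2)) ^ 2 = (1 + t) ^ (n - 1) := by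
    rw [← Real.rpow_natCast, ← Real.rpow_mul ht1.le, ← Real.rpow_natCast]
    congr 1
    rw [Nat.cast_sub (by omega)]
    push_cast
    ring
  have e2 : ((1 + |t - radn x|) ^ (-(1 : ℝ) / 2)) ^ 2 = (1 + |t - radn x|)⁻¹ := by
    rw [← Real.rpow_natCast, ← Real.rpow_mul hA.le, ← Real.rpow_neg_one]
    congr 1
    norm_num
  rw [mul_pow, mul_pow, mul_pow, e1, e2, sq_abs, Real.sq_sqrt hC.le]
  calc _ = (1 + |t - radn x|)⁻¹ * ((1 + t) ^ (n - 1) * φ (Fin.cons t x) ^ 2) := by ring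
    _ ≤ (1 + |t - radn x|)⁻¹ * (C * (1 + |t - radn x|) * Den n φ t) := by gcongr
    _ = C * Den n φ t := by field_simp
    _ ≤ C * T ^ 2 := by gcongr
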